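/- arXiv:math/0609185 — 3 statements merged into one kernel-verified Lean document; each statement's English description precedes it below -/
import Mathlib

section
/- Let n ≥ 1 and 0 < r < ∞. There exists a constant c = c(n, r) > 0 such that for every C¹ function g : ℝⁿ → ℂ, every z₀ ∈ ℝⁿ and every δ > 0, |g(z₀)| ≤ δ · sup_{|z − z₀| ≤ δ} |∇g(z)| + c · δ^{−n/r} ( ∫_{|z − z₀| ≤ δ} |g(z)|^r dz )^{1/r}. (This is the mean-value-theorem inequality used in the proof of Lemma 2.2.) -/
open MeasureTheory Real

/-- On a closed ball, a `C¹` function on a proper space differs from its value at the centre by at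
most the radius times the supremum of the norm of the derivative. -/
lemma norm_center_le_radius_mul_iSup_fderiv_add {E F : Type*} [NormedAddCommGroup E]
    [NormedSpace ℝ E] [ProperSpace E] [NormedAddCommGroup F] [NormedSpace ℝ F] {g : E → F}
    (hg : ContDiff ℝ 1 g) {z₀ z : E} {δ : ℝ} (hδ : 0 ≤ δ) (hz : z ∈ Metric.closedBall z₀ δ) :
    ‖g z₀‖ ≤ δ * (⨆ w : (Metric.closedBall z₀ δ : Set E), ‖fderiv ℝ g (w : E)‖) + ‖g z‖ := by
  have hcont : Continuous fun w : E => ‖fderiv ℝ g w‖ := (hg.continuous_fderiv one_ne_zero).norm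
  have hbdd : BddAbove (Set.range fun w : (Metric.closedBall z₀ δ : Set E) =>
      ‖fderiv ℝ g (w : E)‖) := by
    have h := (isCompact_closedBall z₀ δ).bddAbove_image hcont.continuousOn
    rwa [Set.image_eq_range] at h
  have hmvt : ‖g z₀ - g z‖ ≤
      (⨆ w : (Metric.closedBall z₀ δ : Set E), ‖fderiv ℝ g (w : E)‖) * ‖z₀ - z‖ :=
    (convex_closedBall z₀ δ).norm_image_sub_le_of_norm_fderiv_le
      (fun w _ => (hg.differentiable one_ne_zero) w) (fun w hw => le_ciSup hbdd ⟨w, hw⟩)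
      hz (Metric.mem_closedBall_self hδ)
  have hdist : ‖z₀ - z‖ ≤ δ := by
    rw [← dist_eq_norm, dist_comm]
    exact hz
  have hsup : 0 ≤ ⨆ w : (Metric.closedBall z₀ δ : Set E), ‖fderiv ℝ g (w : E)‖ :=
    Real.iSup_nonneg fun _ => norm_nonneg _
  have htri := norm_sub_norm_le (g z₀) (g z)
  nlinarith [mul_le_mul_of_nonneg_left hdist hsup]

/-- A nonnegative lower bound of `f ≥ 0` on a set of finite positive measure is controlled by the
`r`-mean of `f` over this set. -/
lemma le_measureReal_rpow_mul_setIntegral_rpow {α : Type*} [MeasurableSpace α] {μ : Measure α}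
    {s : Set α} (hs : MeasurableSet s) (hμ : 0 < μ.real s) {f : α → ℝ} {r a : ℝ} (hr : 0 < r)
    (ha : 0 ≤ a) (hfi : IntegrableOn (fun x => f x ^ r) s μ) (haf : ∀ x ∈ s, a ≤ f x) :
    a ≤ μ.real s ^ (-(1 / r)) * (∫ x in s, f x ^ r ∂μ) ^ (1 / r) := by
  have hfin : μ s ≠ ⊤ := fun h => by simp [measureReal_def, h] at hμ
  have hint : a ^ r * μ.real s ≤ ∫ x in s, f x ^ r ∂μ :=
    setIntegral_ge_of_const_le_real hs hfin
      (fun x hx => Real.rpow_le_rpow ha (haf x hx) hr.le) hfi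
  have hpow := Real.rpow_le_rpow (by positivity) hint (by positivity : 0 ≤ 1 / r)
  rw [Real.mul_rpow (by positivity) hμ.le, ← Real.rpow_mul ha, mul_one_div_cancel hr.ne',
    Real.rpow_one] at hpow
  rw [Real.rpow_neg hμ.le, ← div_eq_inv_mul, le_div_iff₀ (by positivity)]
  exact hpow

/-- The mean-value-theorem inequality used in the proof of Lemma 2.2:
for `0 < r < ∞` there is `c = c(n,r) > 0` such that for every `C¹` function
`g : ℝⁿ → ℂ`, every `z₀` and every `δ > 0`,
`|g(z₀)| ≤ δ · sup_{|z−z₀|≤δ} |∇g(z)| + c δ^{−n/r} (∫_{|z−z₀|≤δ} |g|^r)^{1/r}`. -/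
theorem mean_value_theorem_inequality
    (n : ℕ) (hn : 1 ≤ n) (r : ℝ) (hr : 0 < r) :
    ∃ c > (0 : ℝ), ∀ g : EuclideanSpace ℝ (Fin n) → ℂ, ContDiff ℝ 1 g →
      ∀ (z₀ : EuclideanSpace ℝ (Fin n)) (δ : ℝ), 0 < δ →
        ‖g z₀‖ ≤ δ * (⨆ z : (Metric.closedBall z₀ δ : Set (EuclideanSpace ℝ (Fin n))),
              ‖fderiv ℝ g (z : EuclideanSpace ℝ (Fin n))‖)
          + c * δ ^ (-((n : ℝ) / r)) *
              (∫ z in Metric.closedBall z₀ δ, ‖g z‖ ^ r) ^ (1 / r) := by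
  have hV : 0 < volume.real (Metric.closedBall (0 : EuclideanSpace ℝ (Fin n)) 1) :=
    ENNReal.toReal_pos (Metric.measure_closedBall_pos _ _ one_pos).ne'
      measure_closedBall_lt_top.ne
  refine ⟨volume.real (Metric.closedBall (0 : EuclideanSpace ℝ (Fin n)) 1) ^ (-(1 / r)),
    by positivity, fun g hg z₀ δ hδ => ?_⟩
  have hvol : volume.real (Metric.closedBall z₀ δ) =
      δ ^ n * volume.real (Metric.closedBall (0 : EuclideanSpace ℝ (Fin n)) 1) := by
    rw [measureReal_def, Measure.addHaar_closedBall' _ _ hδ.le, ENNReal.toReal_mul,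
      ENNReal.toReal_ofReal (by positivity), finrank_euclideanSpace_fin, measureReal_def]
  have hconst : volume.real (Metric.closedBall z₀ δ) ^ (-(1 / r)) =
      volume.real (Metric.closedBall (0 : EuclideanSpace ℝ (Fin n)) 1) ^ (-(1 / r)) *
        δ ^ (-((n : ℝ) / r)) := by
    rw [hvol, Real.mul_rpow (by positivity) hV.le, ← Real.rpow_natCast, ← Real.rpow_mul hδ.le,
      mul_comm, mul_neg, mul_one_div]
  rw [← hconst, ← sub_le_iff_le_add']
  have hI : 0 ≤ ∫ z in Metric.closedBall z₀ δ, ‖g z‖ ^ r :=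
    integral_nonneg fun z => by positivity
  rcases le_total (‖g z₀‖ - δ * ⨆ z : (Metric.closedBall z₀ δ :
      Set (EuclideanSpace ℝ (Fin n))), ‖fderiv ℝ g (z : EuclideanSpace ℝ (Fin n))‖) 0 with ha | ha
  · exact ha.trans (by positivity)
  · refine le_measureReal_rpow_mul_setIntegral_rpow measurableSet_closedBall
      (by rw [hvol]; positivity) hr ha ?_ fun z hz => ?_
    · exact (hg.continuous.norm.rpow_const fun _ => Or.inr hr.le).continuousOn.integrableOn_compact
        (isCompact_closedBall z₀ δ)
    · rw [sub_le_iff_le_add']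
      exact norm_center_le_radius_mul_iSup_fderiv_add hg hδ.le hz
end

section
/- Let n ≥ 1, 1 < p < ∞ and 1 < q ≤ ∞. There exists a constant C = C(n, p, q) > 0 such that for every sequence (f_j)_{j∈ℤ} of measurable functions on ℝⁿ, ‖ ( Σ_j (M f_j)^q )^{1/q} ‖_{L^p(ℝⁿ)} ≤ C ‖ ( Σ_j |f_j|^q )^{1/q} ‖_{L^p(ℝⁿ)} (with the supremum over j replacing the ℓ^q sum when q = ∞), where M denotes the Hardy–Littlewood maximal operator. (This is Lemma 2.3(b), the Fefferman–Stein vector-valued maximal inequality.) -/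
open MeasureTheory ENNReal Real

/-- The Hardy–Littlewood maximal function
`M f(x) = sup_{ρ>0} |B(x,ρ)|⁻¹ ∫_{B(x,ρ)} |f(y)| dy`. -/
noncomputable def hlMax {n : ℕ} (f : EuclideanSpace ℝ (Fin n) → ℝ)
    (x : EuclideanSpace ℝ (Fin n)) : ℝ≥0∞ :=
  ⨆ (ρ : ℝ) (_ : 0 < ρ),
    (volume (Metric.ball x ρ))⁻¹ * ∫⁻ y in Metric.ball x ρ, ENNReal.ofReal |f y|

/-- The `ℓ^q(ℤ)` norm of a sequence of extended nonnegative reals, with the usual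
supremum modification when `q = ∞`. -/
noncomputable def lqNormZ (q : ℝ≥0∞) (a : ℤ → ℝ≥0∞) : ℝ≥0∞ :=
  if q = ∞ then ⨆ j, a j else (∑' j, a j ^ q.toReal) ^ (1 / q.toReal)


section MaximalFunction

open Metric Set

/-- The centered maximal function of `g` with respect to the measure `μ`. -/
noncomputable def maximalFunction {E : Type*} [PseudoMetricSpace E] [MeasurableSpace E]
    (μ : Measure E) (g : E → ℝ≥0∞) (x : E) : ℝ≥0∞ :=
  ⨆ (ρ : ℝ) (_ : 0 < ρ), (μ (ball x ρ))⁻¹ * ∫⁻ y in ball x ρ, g y ∂μ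

section Metric

variable {E : Type*} [PseudoMetricSpace E] [MeasurableSpace E] {μ : Measure E}

theorem average_le_maximalFunction (g : E → ℝ≥0∞) (x : E) {ρ : ℝ} (hρ : 0 < ρ) :
    (μ (ball x ρ))⁻¹ * ∫⁻ y in ball x ρ, g y ∂μ ≤ maximalFunction μ g x :=
  le_iSup₂ (f := fun (ρ : ℝ) (_ : 0 < ρ) => (μ (ball x ρ))⁻¹ * ∫⁻ y in ball x ρ, g y ∂μ) ρ hρ

theorem maximalFunction_mono {f g : E → ℝ≥0∞} (h : f ≤ g) (x : E) :
    maximalFunction μ f x ≤ maximalFunction μ g x :=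
  iSup₂_mono fun _ _ => mul_le_mul_right (lintegral_mono h) _

theorem maximalFunction_le_add_const {f g : E → ℝ≥0∞} {c : ℝ≥0∞} (h : ∀ y, f y ≤ g y + c)
    (x : E) : maximalFunction μ f x ≤ maximalFunction μ g x + c := by
  refine iSup₂_le fun ρ hρ => ?_
  calc (μ (ball x ρ))⁻¹ * ∫⁻ y in ball x ρ, f y ∂μ
      ≤ (μ (ball x ρ))⁻¹ * ∫⁻ y in ball x ρ, (g y + c) ∂μ :=
        mul_le_mul_right (lintegral_mono h) _
    _ = (μ (ball x ρ))⁻¹ * ∫⁻ y in ball x ρ, g y ∂μ + c * ((μ (ball x ρ))⁻¹ * μ (ball x ρ)) := by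
        rw [lintegral_add_right _ measurable_const, setLIntegral_const]; ring
    _ ≤ maximalFunction μ g x + c * 1 :=
        add_le_add (average_le_maximalFunction g x hρ)
          (mul_le_mul_right (ENNReal.inv_mul_le_one _) _)
    _ = _ := by rw [mul_one]

theorem maximalFunction_tsum_const_mul_le {ι : Type*} [Countable ι] {f : ι → E → ℝ≥0∞}
    (hf : ∀ i, Measurable (f i)) (c : ι → ℝ≥0∞) (x : E) :
    maximalFunction μ (fun y => ∑' i, c i * f i y) x ≤ ∑' i, c i * maximalFunction μ (f i) x := by
  refine iSup₂_le fun ρ hρ => ?_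
  rw [lintegral_tsum fun i => ((hf i).const_mul (c i)).aemeasurable, ← ENNReal.tsum_mul_left]
  refine ENNReal.tsum_le_tsum fun i => ?_
  rw [lintegral_const_mul _ (hf i), mul_left_comm]
  exact mul_le_mul_right (average_le_maximalFunction _ _ hρ) _

theorem lowerSemicontinuous_setLIntegral_ball [OpensMeasurableSpace E] (g : E → ℝ≥0∞) (ρ : ℝ) :
    LowerSemicontinuous fun x => ∫⁻ y in ball x ρ, g y ∂μ := by
  intro x t ht
  have hball : ball x ρ = ⋃ k : ℕ, ball x (ρ - 1 / (k + 1)) := by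
    ext y
    simp only [mem_ball, mem_iUnion]
    constructor
    · intro h
      obtain ⟨k, hk⟩ := exists_nat_one_div_lt (sub_pos.2 h)
      exact ⟨k, by linarith⟩
    · rintro ⟨k, hk⟩
      have : (0 : ℝ) < 1 / (k + 1) := by positivity
      linarith
  have hmono : Monotone fun k : ℕ => ball x (ρ - 1 / ((k : ℝ) + 1)) := by
    intro a b hab
    apply ball_subset_ball
    have := one_div_le_one_div_of_le (by positivity : (0 : ℝ) < a + 1)
      (by exact_mod_cast Nat.succ_le_succ hab : (a : ℝ) + 1 ≤ b + 1)
    linarith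
  obtain ⟨k, hk⟩ : ∃ k : ℕ, t < ∫⁻ y in ball x (ρ - 1 / ((k : ℝ) + 1)), g y ∂μ := by
    simp only [gt_iff_lt] at ht
    rw [hball, setLIntegral_iUnion_of_directed _ hmono.directed_le] at ht
    exact lt_iSup_iff.1 ht
  filter_upwards [ball_mem_nhds x (by positivity : (0 : ℝ) < 1 / (k + 1))] with z hz
  refine hk.trans_le (lintegral_mono_set (ball_subset_ball' ?_))
  rw [mem_ball, dist_comm] at hz
  linarith

end Metric

section Besicovitch

variable (E : Type*) [MetricSpace E] [SecondCountableTopology E] [MeasurableSpace E]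
  [OpensMeasurableSpace E] [HasBesicovitchCovering E]

theorem exists_mul_measure_maximalFunction_gt_le :
    ∃ N : ℕ, ∀ (μ : Measure E) (g : E → ℝ≥0∞) (t : ℝ≥0∞),
      t * μ {x | t < maximalFunction μ g x} ≤ N * ∫⁻ x, g x ∂μ := by
  obtain ⟨N, τ, hτ, hN⟩ := HasBesicovitchCovering.no_satelliteConfig (α := E)
  refine ⟨N, fun μ g t => ?_⟩
  let S : ℕ → Set E := fun R => {x | ∃ ρ : ℝ, 0 < ρ ∧ ρ ≤ R ∧
    t < (μ (ball x ρ))⁻¹ * ∫⁻ y in ball x ρ, g y ∂μ}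
  have hS : {x | t < maximalFunction μ g x} = ⋃ R, S R := by
    ext x
    simp only [maximalFunction, mem_ofPred_eq, lt_iSup_iff, mem_iUnion, S]
    constructor
    · rintro ⟨ρ, hρ, h⟩
      obtain ⟨R, hR⟩ := exists_nat_ge ρ
      exact ⟨R, ρ, hρ, hR, h⟩
    · rintro ⟨R, ρ, hρ, -, h⟩
      exact ⟨ρ, hρ, h⟩
  have hmono : Monotone S := by
    rintro a b hab x ⟨ρ, hρ, hρa, h⟩
    exact ⟨ρ, hρ, hρa.trans (by exact_mod_cast hab), h⟩
  rw [hS, hmono.measure_iUnion, ENNReal.mul_iSup]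
  refine iSup_le fun R => ?_
  choose! r hr0 hrR hr using fun x (hx : x ∈ S R) => hx
  let B : Besicovitch.BallPackage (S R) E :=
    { c := fun x => x, r := fun x => r x, rpos := fun x => hr0 x x.2, r_bound := R,
      r_le := fun x => hrR x x.2 }
  obtain ⟨s, hdisj, hcov⟩ := Besicovitch.exist_disjoint_covering_families hτ hN B
  have hdisj' : ∀ i, (s i).PairwiseDisjoint fun j => ball (B.c j) (B.r j) :=
    fun i => (hdisj i).mono fun _ => ball_subset_closedBall
  have hcount : ∀ i, (s i).Countable := fun i =>
    (hdisj' i).countable_of_isOpen (fun _ _ => isOpen_ball)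
      fun j _ => nonempty_ball.2 (B.rpos j)
  have hball : ∀ j : S R, t * μ (ball (B.c j) (B.r j)) ≤ ∫⁻ y in ball (B.c j) (B.r j), g y ∂μ := by
    intro j
    have h := (hr j j.2).le
    rw [mul_comm, ← div_eq_mul_inv] at h
    exact ENNReal.mul_le_of_le_div h
  have hfam : ∀ i, t * μ (⋃ j ∈ s i, ball (B.c j) (B.r j)) ≤ ∫⁻ y, g y ∂μ := by
    intro i
    calc t * μ (⋃ j ∈ s i, ball (B.c j) (B.r j))
        ≤ t * ∑' j : s i, μ (ball (B.c j) (B.r j)) :=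
          mul_le_mul_right (measure_biUnion_le μ (hcount i) _) _
      _ = ∑' j : s i, t * μ (ball (B.c j) (B.r j)) := ENNReal.tsum_mul_left.symm
      _ ≤ ∑' j : s i, ∫⁻ y in ball (B.c j) (B.r j), g y ∂μ :=
          ENNReal.tsum_le_tsum fun j => hball j
      _ = ∫⁻ y in ⋃ j ∈ s i, ball (B.c j) (B.r j), g y ∂μ :=
          (lintegral_biUnion (hcount i) (fun _ _ => measurableSet_ball) (hdisj' i) g).symm
      _ ≤ ∫⁻ y, g y ∂μ := setLIntegral_le_lintegral _ _
  calc t * μ (S R) ≤ t * μ (⋃ i, ⋃ j ∈ s i, ball (B.c j) (B.r j)) := by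
        refine mul_le_mul_right (measure_mono fun x hx => hcov ⟨⟨x, hx⟩, rfl⟩) _
    _ ≤ t * ∑ i, μ (⋃ j ∈ s i, ball (B.c j) (B.r j)) :=
        mul_le_mul_right (measure_iUnion_fintype_le μ _) _
    _ = ∑ i, t * μ (⋃ j ∈ s i, ball (B.c j) (B.r j)) := Finset.mul_sum _ _ _
    _ ≤ ∑ _i : Fin N, ∫⁻ y, g y ∂μ := Finset.sum_le_sum fun i _ => hfam i
    _ = N * ∫⁻ x, g x ∂μ := by simp

end Besicovitch

section Dyadic

theorem rpow_le_tsum_dyadic {s : ℝ} (hs : 0 < s) (a : ℝ≥0∞) :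
    a ^ s ≤ ∑' k : ℤ, (4 * 2 ^ k : ℝ≥0∞) ^ s * (Ioi (2 * 2 ^ k : ℝ≥0∞)).indicator 1 a := by
  have key : ∀ k : ℤ, (2 * 2 ^ k : ℝ≥0∞) < a → (4 * 2 ^ k : ℝ≥0∞) ^ s ≤
      ∑' k : ℤ, (4 * 2 ^ k : ℝ≥0∞) ^ s * (Ioi (2 * 2 ^ k : ℝ≥0∞)).indicator 1 a := fun k hk =>
    le_trans (by simp [hk]) (ENNReal.le_tsum k)
  have hz : ∀ k : ℤ, (2 * 2 ^ k : ℝ≥0∞) = 2 ^ (k + 1) := fun k => by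
    rw [ENNReal.zpow_add two_ne_zero ofNat_ne_top, zpow_one, mul_comm]
  have hz' : ∀ k : ℤ, (4 * 2 ^ k : ℝ≥0∞) = 2 ^ (k + 2) := fun k => by
    rw [ENNReal.zpow_add two_ne_zero ofNat_ne_top, mul_comm]; norm_num
  rcases eq_or_ne a 0 with rfl | h0
  · simp [hs]
  rcases eq_or_ne a ∞ with rfl | htop
  · have hlt : ∀ k : ℤ, (2 * 2 ^ k : ℝ≥0∞) < ∞ := fun k => by
      rw [hz]; exact ENNReal.zpow_lt_top two_ne_zero ofNat_ne_top _
    have hle : ∀ k : ℕ, (k : ℝ≥0∞) ≤ (∑' k : ℤ, (4 * 2 ^ k : ℝ≥0∞) ^ s *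
        (Ioi (2 * 2 ^ k : ℝ≥0∞)).indicator 1 ∞) ^ (1 / s) := fun k => by
      have h1 : (k : ℝ≥0∞) ≤ 4 * 2 ^ (k : ℤ) := by
        rw [zpow_natCast]
        calc (k : ℝ≥0∞) ≤ 2 ^ k := by exact_mod_cast Nat.lt_two_pow_self.le
          _ = 1 * 2 ^ k := (one_mul _).symm
          _ ≤ 4 * 2 ^ k := by gcongr; norm_num
      refine h1.trans ?_
      rw [one_div, ENNReal.le_rpow_inv_iff hs]
      exact key k (hlt k)
    have := ENNReal.eq_top_of_forall_nnreal_le (x := (∑' k : ℤ, (4 * 2 ^ k : ℝ≥0∞) ^ s *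
        (Ioi (2 * 2 ^ k : ℝ≥0∞)).indicator 1 ∞) ^ (1 / s)) fun r => by
      obtain ⟨k, hk⟩ := exists_nat_ge r
      exact le_trans (by exact_mod_cast hk) (hle k)
    rw [ENNReal.rpow_eq_top_iff_of_pos (by positivity)] at this
    rw [this]; exact le_top
  obtain ⟨k, hk1, hk2⟩ := ENNReal.exists_mem_Ioc_zpow h0 htop one_lt_two ofNat_ne_top
  have h := key (k - 1) (by rw [hz]; simpa using hk1)
  refine le_trans (ENNReal.rpow_le_rpow ?_ hs.le) h
  rw [hz']
  rwa [show k - 1 + 2 = k + 1 by ring]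

theorem exists_tsum_dyadic_le_rpow {u : ℝ} (hu : 0 < u) :
    ∃ C : ℝ≥0∞, C ≠ ∞ ∧ ∀ a : ℝ≥0∞,
      ∑' k : ℤ, (2 ^ k : ℝ≥0∞) ^ u * (Ioi (2 ^ k : ℝ≥0∞)).indicator 1 a ≤ C * a ^ u := by
  have hlt : (2⁻¹ : ℝ≥0∞) ^ u < 1 := ENNReal.rpow_lt_one ENNReal.one_half_lt_one hu
  have hne : (1 - (2⁻¹ : ℝ≥0∞) ^ u)⁻¹ ≠ ∞ := ENNReal.inv_ne_top.2 (tsub_pos_of_lt hlt).ne'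
  refine ⟨(1 - (2⁻¹ : ℝ≥0∞) ^ u)⁻¹, hne, fun a => ?_⟩
  rcases eq_or_ne a 0 with rfl | h0
  · simp
  rcases eq_or_ne a ∞ with rfl | htop
  · rw [ENNReal.top_rpow_of_pos hu, ENNReal.mul_top (by simp)]
    exact le_top
  obtain ⟨K, hK1, hK2⟩ := ENNReal.exists_mem_Ioc_zpow h0 htop one_lt_two ofNat_ne_top
  have hinj : Function.Injective fun m : ℕ => K - (m : ℤ) := fun a b h => by
    simpa using h
  rw [← hinj.tsum_eq]
  · calc ∑' m : ℕ, (2 ^ (K - (m : ℤ)) : ℝ≥0∞) ^ u *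
          (Ioi (2 ^ (K - (m : ℤ)) : ℝ≥0∞)).indicator 1 a
        ≤ ∑' m : ℕ, (2 ^ K : ℝ≥0∞) ^ u * ((2⁻¹ : ℝ≥0∞) ^ u) ^ m := by
          refine ENNReal.tsum_le_tsum fun m => ?_
          have h1 : (2 ^ (K - (m : ℤ)) : ℝ≥0∞) ^ u =
              (2 ^ K : ℝ≥0∞) ^ u * ((2⁻¹ : ℝ≥0∞) ^ u) ^ m := by
            rw [sub_eq_add_neg, ENNReal.zpow_add two_ne_zero ofNat_ne_top,
              ENNReal.mul_rpow_of_nonneg _ _ hu.le, ENNReal.zpow_neg, zpow_natCast,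
              ENNReal.inv_pow, ← ENNReal.rpow_natCast, ← ENNReal.rpow_natCast,
              ← ENNReal.rpow_mul, ← ENNReal.rpow_mul, mul_comm u]
          rw [h1]
          refine mul_le_of_le_one_right' ?_
          exact indicator_le_self' (fun _ _ => zero_le) a
      _ = (1 - (2⁻¹ : ℝ≥0∞) ^ u)⁻¹ * (2 ^ K : ℝ≥0∞) ^ u := by
          rw [ENNReal.tsum_mul_left, ENNReal.tsum_geometric, mul_comm]
      _ ≤ _ := by gcongr
  · intro k hk
    have hk' : (2 ^ k : ℝ≥0∞) < a := by
      by_contra h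
      exact hk (by simp [h])
    have h3 : (2 : ℝ≥0∞) ^ k < 2 ^ (K + 1) := hk'.trans_le hK2
    have h4 : k < K + 1 := by
      by_contra h
      exact absurd (ENNReal.zpow_le_of_le one_le_two (not_lt.1 h)) (not_le.2 h3)
    exact ⟨(K - k).toNat, by simp only; omega⟩

end Dyadic

section StrongType

variable (E : Type*) [MetricSpace E] [SecondCountableTopology E] [MeasurableSpace E]
  [OpensMeasurableSpace E] [HasBesicovitchCovering E]

theorem exists_lintegral_maximalFunction_rpow_le {s : ℝ} (hs : 1 < s) :
    ∃ A : ℝ≥0∞, A ≠ ∞ ∧ ∀ (μ : Measure E) (g : E → ℝ≥0∞), Measurable g →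
      ∫⁻ x, maximalFunction μ g x ^ s ∂μ ≤ A * ∫⁻ x, g x ^ s ∂μ := by
  obtain ⟨N, hN⟩ := exists_mul_measure_maximalFunction_gt_le E
  obtain ⟨C, hC, hdy⟩ := exists_tsum_dyadic_le_rpow (sub_pos.2 hs)
  have hs0 : 0 < s := by linarith
  refine ⟨4 ^ s * N * C, by finiteness, fun μ g hg => ?_⟩
  have hlevel : ∀ k : ℤ, (2 ^ k : ℝ≥0∞) * μ {x | (2 * 2 ^ k : ℝ≥0∞) < maximalFunction μ g x} ≤
      N * ∫⁻ x, (Ioi (2 ^ k : ℝ≥0∞)).indicator 1 (g x) * g x ∂μ := by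
    intro k
    have hk : (2 ^ k : ℝ≥0∞) ≠ ∞ := (ENNReal.zpow_lt_top two_ne_zero ofNat_ne_top k).ne
    refine le_trans (mul_le_mul_right (measure_mono fun x hx => ?_) _)
      (hN μ (fun x => (Ioi (2 ^ k : ℝ≥0∞)).indicator 1 (g x) * g x) (2 ^ k))
    have h := maximalFunction_le_add_const (μ := μ) (f := g)
      (g := fun x => (Ioi (2 ^ k : ℝ≥0∞)).indicator 1 (g x) * g x) (c := 2 ^ k) (fun y => by
        by_cases hy : (2 ^ k : ℝ≥0∞) < g y
        · simp [hy]
        · simpa [hy] using not_lt.1 hy) x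
    have hx' := lt_of_lt_of_le hx h
    rw [two_mul] at hx'
    exact (ENNReal.add_lt_add_iff_right hk).1 hx'
  have hterm : ∀ k : ℤ, (4 * 2 ^ k : ℝ≥0∞) ^ s *
      μ {x | (2 * 2 ^ k : ℝ≥0∞) < maximalFunction μ g x} ≤
      4 ^ s * N * ∫⁻ x, (2 ^ k : ℝ≥0∞) ^ (s - 1) * (Ioi (2 ^ k : ℝ≥0∞)).indicator 1 (g x) *
        g x ∂μ := by
    intro k
    have hk0 : (2 ^ k : ℝ≥0∞) ≠ 0 := (ENNReal.zpow_pos two_ne_zero ofNat_ne_top k).ne'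
    have hk : (2 ^ k : ℝ≥0∞) ≠ ∞ := (ENNReal.zpow_lt_top two_ne_zero ofNat_ne_top k).ne
    have hpow : (2 ^ k : ℝ≥0∞) ^ s = (2 ^ k : ℝ≥0∞) ^ (s - 1) * 2 ^ k := by
      rw [ENNReal.rpow_sub _ _ hk0 hk, ENNReal.rpow_one, ENNReal.div_mul_cancel hk0 hk]
    have hmeas : Measurable fun x => (Ioi (2 ^ k : ℝ≥0∞)).indicator (1 : ℝ≥0∞ → ℝ≥0∞) (g x) * g x :=
      ((measurable_one.indicator measurableSet_Ioi).comp hg).mul hg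
    simp_rw [mul_assoc ((2 ^ k : ℝ≥0∞) ^ (s - 1))]
    rw [lintegral_const_mul _ hmeas, ENNReal.mul_rpow_of_nonneg _ _ hs0.le, hpow]
    calc 4 ^ s * ((2 ^ k : ℝ≥0∞) ^ (s - 1) * 2 ^ k) *
          μ {x | (2 * 2 ^ k : ℝ≥0∞) < maximalFunction μ g x}
        = 4 ^ s * (2 ^ k : ℝ≥0∞) ^ (s - 1) *
          (2 ^ k * μ {x | (2 * 2 ^ k : ℝ≥0∞) < maximalFunction μ g x}) := by ring
      _ ≤ 4 ^ s * (2 ^ k : ℝ≥0∞) ^ (s - 1) *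
          (N * ∫⁻ x, (Ioi (2 ^ k : ℝ≥0∞)).indicator 1 (g x) * g x ∂μ) := by
          exact mul_le_mul_right (hlevel k) _
      _ = _ := by ring
  let T : ℤ → Set E := fun k => toMeasurable μ {x | (2 * 2 ^ k : ℝ≥0∞) < maximalFunction μ g x}
  have hT : ∀ k, MeasurableSet (T k) := fun k => measurableSet_toMeasurable _ _
  calc ∫⁻ x, maximalFunction μ g x ^ s ∂μ
      ≤ ∫⁻ x, ∑' k : ℤ, (4 * 2 ^ k : ℝ≥0∞) ^ s * (T k).indicator 1 x ∂μ := by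
        refine lintegral_mono fun x => (rpow_le_tsum_dyadic hs0 _).trans
          (ENNReal.tsum_le_tsum fun k => mul_le_mul_right ?_ _)
        by_cases hx : (2 * 2 ^ k : ℝ≥0∞) < maximalFunction μ g x
        · have : x ∈ T k := subset_toMeasurable μ _ hx
          simp [hx, this]
        · simp [hx]
    _ = ∑' k : ℤ, (4 * 2 ^ k : ℝ≥0∞) ^ s *
          μ {x | (2 * 2 ^ k : ℝ≥0∞) < maximalFunction μ g x} := by
        rw [lintegral_tsum fun k =>
          ((measurable_one.indicator (hT k)).const_mul _).aemeasurable]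
        refine tsum_congr fun k => ?_
        rw [lintegral_const_mul _ (measurable_one.indicator (hT k)), lintegral_indicator_one (hT k),
          measure_toMeasurable]
    _ ≤ ∑' k : ℤ, 4 ^ s * N * ∫⁻ x, (2 ^ k : ℝ≥0∞) ^ (s - 1) *
          (Ioi (2 ^ k : ℝ≥0∞)).indicator 1 (g x) * g x ∂μ := ENNReal.tsum_le_tsum hterm
    _ = 4 ^ s * N * ∫⁻ x, (∑' k : ℤ, (2 ^ k : ℝ≥0∞) ^ (s - 1) *
          (Ioi (2 ^ k : ℝ≥0∞)).indicator 1 (g x)) * g x ∂μ := by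
        rw [ENNReal.tsum_mul_left, ← lintegral_tsum]
        · simp_rw [ENNReal.tsum_mul_right]
        · exact fun k => ((((measurable_one.indicator measurableSet_Ioi).comp hg).const_mul
            _).mul hg).aemeasurable
    _ ≤ 4 ^ s * N * ∫⁻ x, C * g x ^ s ∂μ := by
        refine mul_le_mul_right (lintegral_mono fun x => ?_) _
        calc _ ≤ C * g x ^ (s - 1) * g x := mul_le_mul_left (hdy _) _
          _ = C * g x ^ s := by
            conv_lhs => rw [mul_assoc, ← ENNReal.rpow_one (g x), ← ENNReal.rpow_mul, one_mul]
            rw [← ENNReal.rpow_add_of_nonneg _ _ (by linarith) zero_le_one, sub_add_cancel]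
    _ = _ := by rw [lintegral_const_mul _ (hg.pow_const s)]; ring

end StrongType

theorem tsum_mul_le_Lp_mul_Lq {ι : Type*} {p q : ℝ} (hpq : p.HolderConjugate q)
    (f g : ι → ℝ≥0∞) :
    ∑' i, f i * g i ≤ (∑' i, f i ^ p) ^ (1 / p) * (∑' i, g i ^ q) ^ (1 / q) := by
  let _ : MeasurableSpace ι := ⊤
  simpa [lintegral_count] using ENNReal.lintegral_mul_le_Lp_mul_Lq Measure.count hpq
    (measurable_from_top (f := f)).aemeasurable (measurable_from_top (f := g)).aemeasurable

theorem measurable_maximalFunction {E : Type*} [NormedAddCommGroup E] [MeasurableSpace E]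
    [BorelSpace E] (ν : Measure E) [ν.IsAddHaarMeasure] (g : E → ℝ≥0∞) :
    Measurable (maximalFunction ν g) := by
  refine LowerSemicontinuous.measurable (lowerSemicontinuous_biSup fun ρ hρ => ?_)
  simp_rw [Measure.addHaar_ball_center ν]
  refine (ENNReal.continuous_const_mul ?_).comp_lowerSemicontinuous
    (lowerSemicontinuous_setLIntegral_ball g ρ) fun a b h => mul_le_mul_right h _
  exact ENNReal.inv_ne_top.2 (measure_ball_pos ν 0 hρ).ne'

theorem lintegral_mul_tsum_maximalFunction_le {E : Type*} [NormedAddCommGroup E]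
    [MeasurableSpace E] [BorelSpace E] {ν : Measure E} [ν.IsAddHaarMeasure] {ι : Type*}
    [Countable ι] {w : E → ℝ≥0∞} (hw : Measurable w) {q : ℝ}
    {C : ℝ≥0∞} (hC : ∀ f : E → ℝ≥0∞, Measurable f →
      ∫⁻ x, w x * maximalFunction ν f x ^ q ∂ν ≤ C * ∫⁻ x, w x * f x ^ q ∂ν)
    {f : ι → E → ℝ≥0∞} (hf : ∀ j, Measurable (f j)) :
    ∫⁻ x, w x * ∑' j, maximalFunction ν (f j) x ^ q ∂ν ≤
      C * ∫⁻ x, w x * ∑' j, f j x ^ q ∂ν := by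
  have hM : ∀ j, Measurable fun x => w x * maximalFunction ν (f j) x ^ q := fun j =>
    hw.mul ((measurable_maximalFunction ν (f j)).pow_const q)
  have hfw : ∀ j, Measurable fun x => w x * f j x ^ q := fun j => hw.mul ((hf j).pow_const q)
  simp_rw [← ENNReal.tsum_mul_left]
  rw [lintegral_tsum fun j => (hM j).aemeasurable, lintegral_tsum fun j => (hfw j).aemeasurable,
    ← ENNReal.tsum_mul_left]
  exact ENNReal.tsum_le_tsum fun j => hC _ (hf j)

theorem ae_eq_zero_or_forall_ne_zero_of_maximalFunction_le {E : Type*}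
    [NormedAddCommGroup E] [ProperSpace E] [MeasurableSpace E] [OpensMeasurableSpace E]
    {ν : Measure E} [ν.IsAddHaarMeasure] {A : ℝ≥0∞} {h : E → ℝ≥0∞}
    (hm : Measurable h) (hA : ∀ x, maximalFunction ν h x ≤ A * h x) :
    h =ᵐ[ν] 0 ∨ ∀ x, h x ≠ 0 := by
  by_contra! H
  obtain ⟨h1, x, hx⟩ := H
  refine h1 ?_
  have hM : maximalFunction ν h x = 0 := by simpa [hx] using hA x
  have hz : ∀ k : ℕ, ∫⁻ y in ball x k, h y ∂ν = 0 := by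
    intro k
    rcases k.eq_zero_or_pos with rfl | hk
    · simp
    have := (average_le_maximalFunction (μ := ν) h x (Nat.cast_pos.2 hk : (0 : ℝ) < k)).trans hM.le
    simpa [ENNReal.inv_eq_zero, measure_ball_lt_top.ne] using this
  rw [← lintegral_eq_zero_iff hm, ← setLIntegral_univ, ← iUnion_ball_nat x,
    setLIntegral_iUnion_of_directed]
  · simp [hz]
  · exact Monotone.directed_le fun a b hab => ball_subset_ball (by exact_mod_cast hab)

theorem lintegral_le_of_forall_le_of_ne_top {α : Type*} [MeasurableSpace α] {μ : Measure α}
    [SigmaFinite μ] {φ : α → ℝ≥0∞} (hφ : Measurable φ) {b : ℝ≥0∞}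
    (H : ∀ g : α → ℝ≥0∞, Measurable g → g ≤ φ → ∫⁻ x, g x ∂μ ≠ ∞ → ∫⁻ x, g x ∂μ ≤ b) :
    ∫⁻ x, φ x ∂μ ≤ b := by
  let g : ℕ → α → ℝ≥0∞ := fun k => (spanningSets μ k).indicator fun x => min (φ x) k
  have hg : ∀ k, Measurable (g k) := fun k =>
    (hφ.min measurable_const).indicator (measurableSet_spanningSets μ k)
  have hmono : Monotone g := fun k l hkl x =>
    (indicator_le_indicator_of_subset (monotone_spanningSets μ hkl) (fun _ => zero_le) x).trans
      (indicator_le_indicator (min_le_min_left _ (by exact_mod_cast hkl)))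
  have hsup : ∀ x, φ x = ⨆ k, g k x := by
    intro x
    refine le_antisymm (le_of_forall_lt fun t ht => ?_)
      (iSup_le fun k => (indicator_le_self' (fun _ _ => zero_le) x).trans (min_le_left _ _))
    obtain ⟨N, hN⟩ := ENNReal.exists_nat_gt ht.ne_top
    let k := max N (spanningSetsIndex μ x)
    refine lt_of_lt_of_le ?_ (le_iSup (fun k => g k x) k)
    have hx : x ∈ spanningSets μ k :=
      monotone_spanningSets μ (le_max_right _ _) (mem_spanningSetsIndex μ x)
    simp only [g, indicator_of_mem hx]
    exact lt_min ht (hN.trans_le (by exact_mod_cast le_max_left _ _))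
  simp_rw [hsup]
  rw [lintegral_iSup hg hmono]
  refine iSup_le fun k => H _ (hg k) (fun x => (hsup x).symm ▸ le_iSup (fun k => g k x) k) ?_
  refine ne_top_of_le_ne_top (b := k * μ (spanningSets μ k)) ?_ ?_
  · exact ENNReal.mul_ne_top (ENNReal.natCast_ne_top k) (measure_spanningSets_lt_top μ k).ne
  · rw [lintegral_indicator (measurableSet_spanningSets μ k), ← setLIntegral_const]
    exact lintegral_mono fun x => min_le_right _ _

section OpenPos

variable {E : Type*} [PseudoMetricSpace E] [MeasurableSpace E] {ν : Measure E}
  [ν.IsOpenPosMeasure]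

theorem exists_mem_ball_of_ae {P : E → Prop} (hP : ∀ᵐ x ∂ν, P x) (x : E) {ρ : ℝ} (hρ : 0 < ρ) :
    ∃ y ∈ ball x ρ, P y := by
  by_contra! H
  exact (measure_ball_pos ν x hρ).ne' (measure_mono_null H (ae_iff.1 hP))

theorem setLIntegral_ball_ne_zero [OpensMeasurableSpace E] {h : E → ℝ≥0∞} (hm : Measurable h)
    (x : E) {ρ : ℝ} (hρ : 0 < ρ) (h0 : ∀ᵐ y ∂ν, h y ≠ 0) : ∫⁻ y in ball x ρ, h y ∂ν ≠ 0 := by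
  rw [Ne, lintegral_eq_zero_iff hm]
  intro hz
  obtain ⟨y, hy, hy1, hy2⟩ := exists_mem_ball_of_ae
    (((ae_restrict_iff' measurableSet_ball).1 hz).and h0) x hρ
  exact hy2 (hy1 hy)

end OpenPos

section Haar

variable {E : Type*} [NormedAddCommGroup E] [NormedSpace ℝ E] [FiniteDimensional ℝ E]
  [MeasurableSpace E] [BorelSpace E] (ν : Measure E) [ν.IsAddHaarMeasure]

theorem average_le_mul_maximalFunction_of_mem_ball (g : E → ℝ≥0∞) {x y : E} {ρ : ℝ}
    (hy : y ∈ ball x ρ) :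
    (ν (ball x ρ))⁻¹ * ∫⁻ z in ball x ρ, g z ∂ν ≤
      2 ^ Module.finrank ℝ E * maximalFunction ν g y := by
  have hρ : 0 < ρ := pos_of_mem_ball hy
  have hvol : ν (ball y (2 * ρ)) = 2 ^ Module.finrank ℝ E * ν (ball x ρ) := by
    rw [Measure.addHaar_ball_mul_of_pos ν y two_pos, Measure.addHaar_ball_center ν x,
      ENNReal.ofReal_pow zero_le_two, ENNReal.ofReal_ofNat]
  have hinv : (ν (ball x ρ))⁻¹ = 2 ^ Module.finrank ℝ E * (ν (ball y (2 * ρ)))⁻¹ := by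
    rw [hvol, ENNReal.mul_inv (by simp) (by simp), ← mul_assoc,
      ENNReal.mul_inv_cancel (by simp) (by simp), one_mul]
  rw [hinv, mul_assoc]
  refine mul_le_mul_right (le_trans ?_ (average_le_maximalFunction g y (by positivity : 0 < 2 * ρ))) _
  refine mul_le_mul_right (lintegral_mono_set (ball_subset_ball' ?_)) _
  rw [mem_ball, dist_comm] at hy
  linarith

/-- The Rubio de Francia algorithm: every function has an `A₁` majorant of comparable norm. -/
theorem exists_majorant_maximalFunction_le {s : ℝ} (hs : 1 < s) :
    ∃ A K : ℝ≥0∞, A ≠ ∞ ∧ K ≠ ∞ ∧ ∀ g : E → ℝ≥0∞, Measurable g → ∃ h : E → ℝ≥0∞, Measurable h ∧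
      g ≤ h ∧ (∀ x, maximalFunction ν h x ≤ A * h x) ∧
      ∫⁻ x, h x ^ s ∂ν ≤ K * ∫⁻ x, g x ^ s ∂ν := by
  obtain ⟨a, ha, hstrong⟩ := exists_lintegral_maximalFunction_rpow_le E hs
  have hs0 : 0 < s := by linarith
  have hconj := (Real.HolderConjugate.conjExponent hs).symm
  set s' := s.conjExponent
  let b : ℝ≥0∞ := (2 * (a + 1)) ^ s⁻¹
  have hb0 : b ≠ 0 := (ENNReal.rpow_pos (by positivity) (by finiteness)).ne'
  have hb : b ≠ ∞ := by finiteness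
  let c : ℝ≥0∞ := (2 * b)⁻¹
  have hc0 : c ≠ 0 := ENNReal.inv_ne_zero.2 (by finiteness)
  have hc : c ≠ ∞ := ENNReal.inv_ne_top.2 (by simp [hb0])
  have h2c : 2 * c = b⁻¹ := by
    simp only [c]
    rw [ENNReal.mul_inv (by simp) (by simp), ← mul_assoc,
      ENNReal.mul_inv_cancel (by simp) (by simp), one_mul]
  have h2cs : (2 * c) ^ s * a ≤ 2⁻¹ := by
    rw [h2c, ENNReal.inv_rpow, ENNReal.rpow_inv_rpow hs0.ne',
      ENNReal.mul_inv (by simp) (by simp), mul_assoc]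
    refine mul_le_of_le_one_right' ?_
    calc (a + 1)⁻¹ * a ≤ (a + 1)⁻¹ * (a + 1) := by gcongr; exact le_self_add
      _ ≤ 1 := ENNReal.inv_mul_le_one _
  refine ⟨c⁻¹, 2 ^ (1 / s' * s) * 2, ENNReal.inv_ne_top.2 hc0, ?_, fun g hg => ?_⟩
  · exact ENNReal.mul_ne_top (ENNReal.rpow_ne_top_of_nonneg
      (mul_nonneg (one_div_nonneg.2 hconj.nonneg) hs0.le) ofNat_ne_top) ofNat_ne_top
  let m : ℕ → E → ℝ≥0∞ := fun k => (maximalFunction ν)^[k] g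
  have hmsucc : ∀ k, m (k + 1) = maximalFunction ν (m k) := fun k =>
    Function.iterate_succ_apply' _ _ _
  have hm : ∀ k, Measurable (m k) := by
    intro k
    cases k with
    | zero => exact hg
    | succ k => rw [hmsucc]; exact measurable_maximalFunction ν _
  have hint : ∀ k, ∫⁻ x, m k x ^ s ∂ν ≤ a ^ k * ∫⁻ x, g x ^ s ∂ν := by
    intro k
    induction k with
    | zero => simp [m]
    | succ k ih =>
      rw [hmsucc, pow_succ', mul_assoc]
      exact (hstrong ν _ (hm k)).trans (mul_le_mul_right ih _)
  refine ⟨fun x => ∑' k, c ^ k * m k x, ?_, fun x => ?_, fun x => ?_, ?_⟩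
  · exact Measurable.tsum fun k => (hm k).const_mul _
  · exact le_trans (by simp [m]) (ENNReal.le_tsum (f := fun k => c ^ k * m k x) 0)
  · refine (maximalFunction_tsum_const_mul_le hm _ x).trans ?_
    have hshift : ∀ k, c ^ k * maximalFunction ν (m k) x = c⁻¹ * (c ^ (k + 1) * m (k + 1) x) := by
      intro k
      rw [hmsucc, pow_succ', ← mul_assoc, ← mul_assoc, ENNReal.inv_mul_cancel hc0 hc, one_mul]
    simp_rw [hshift]
    rw [ENNReal.tsum_mul_left]
    exact mul_le_mul_right (ENNReal.tsum_comp_le_tsum_of_injective (add_left_injective 1)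
      (fun k => c ^ k * m k x)) _
  · have hpt : ∀ x, (∑' k, c ^ k * m k x) ^ s ≤
        2 ^ (1 / s' * s) * ∑' k, ((2 * c) ^ s) ^ k * m k x ^ s := by
      intro x
      have h1 : ∑' k, c ^ k * m k x = ∑' k : ℕ, (2⁻¹ : ℝ≥0∞) ^ k * ((2 * c) ^ k * m k x) := by
        refine tsum_congr fun k => ?_
        rw [← mul_assoc, ← mul_pow, ← mul_assoc, ENNReal.inv_mul_cancel (by simp) (by simp),
          one_mul]
      have h2 : ∑' k : ℕ, ((2⁻¹ : ℝ≥0∞) ^ k) ^ s' ≤ 2 := by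
        calc ∑' k : ℕ, ((2⁻¹ : ℝ≥0∞) ^ k) ^ s' ≤ ∑' k : ℕ, (2⁻¹ : ℝ≥0∞) ^ k := by
              refine ENNReal.tsum_le_tsum fun k => ENNReal.rpow_le_self_of_le_one ?_ hconj.lt.le
              exact pow_le_one₀ zero_le (ENNReal.inv_le_one.2 one_le_two)
          _ = 2 := by rw [ENNReal.tsum_geometric, ENNReal.one_sub_inv_two, inv_inv]
      calc (∑' k, c ^ k * m k x) ^ s
          ≤ (2 ^ (1 / s') * (∑' k, ((2 * c) ^ k * m k x) ^ s) ^ (1 / s)) ^ s := by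
            rw [h1]
            refine ENNReal.rpow_le_rpow ((tsum_mul_le_Lp_mul_Lq hconj _ _).trans ?_) hs0.le
            refine mul_le_mul_left (ENNReal.rpow_le_rpow h2 (one_div_nonneg.2 hconj.nonneg)) _
        _ = 2 ^ (1 / s' * s) * ∑' k, ((2 * c) ^ s) ^ k * m k x ^ s := by
            rw [ENNReal.mul_rpow_of_nonneg _ _ hs0.le, ← ENNReal.rpow_mul, ← ENNReal.rpow_mul,
              one_div_mul_cancel hs0.ne', ENNReal.rpow_one]
            congr 1
            refine tsum_congr fun k => ?_
            rw [ENNReal.mul_rpow_of_nonneg _ _ hs0.le, ← ENNReal.rpow_natCast,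
              ← ENNReal.rpow_natCast, ← ENNReal.rpow_mul, ← ENNReal.rpow_mul, mul_comm (k : ℝ)]
    calc ∫⁻ x, (∑' k, c ^ k * m k x) ^ s ∂ν
        ≤ ∫⁻ x, 2 ^ (1 / s' * s) * ∑' k, ((2 * c) ^ s) ^ k * m k x ^ s ∂ν := lintegral_mono hpt
      _ = 2 ^ (1 / s' * s) * ∑' k, ((2 * c) ^ s) ^ k * ∫⁻ x, m k x ^ s ∂ν := by
          have hk : ∀ k, Measurable fun x => m k x ^ s := fun k => (hm k).pow_const s
          rw [lintegral_const_mul _ (Measurable.tsum fun k => (hk k).const_mul _),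
            lintegral_tsum fun k => ((hk k).const_mul _).aemeasurable]
          simp_rw [lintegral_const_mul _ (hk _)]
      _ ≤ 2 ^ (1 / s' * s) * ∑' k : ℕ, (2⁻¹ : ℝ≥0∞) ^ k * ∫⁻ x, g x ^ s ∂ν := by
          refine mul_le_mul_right (ENNReal.tsum_le_tsum fun k => ?_) _
          calc ((2 * c) ^ s) ^ k * ∫⁻ x, m k x ^ s ∂ν
              ≤ ((2 * c) ^ s) ^ k * (a ^ k * ∫⁻ x, g x ^ s ∂ν) := mul_le_mul_right (hint k) _
            _ = ((2 * c) ^ s * a) ^ k * ∫⁻ x, g x ^ s ∂ν := by rw [mul_pow, mul_assoc]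
            _ ≤ _ := by gcongr
      _ = _ := by
          rw [ENNReal.tsum_mul_right, ENNReal.tsum_geometric, ENNReal.one_sub_inv_two, inv_inv,
            mul_assoc]


section Weights

variable {ν} {A : ℝ≥0∞} {h : E → ℝ≥0∞}

theorem exists_lintegral_mul_maximalFunction_rpow_le_of_pointwise (ν : Measure E)
    [ν.IsAddHaarMeasure] {r q : ℝ} (hr : 0 < r) (hrq : r < q) :
    ∃ C : ℝ≥0∞, C ≠ ∞ ∧ ∀ (w f : E → ℝ≥0∞) (D : ℝ≥0∞), Measurable w → Measurable f → D ≠ ∞ →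
      (∀ x, maximalFunction ν f x ^ r ≤
        D * maximalFunction (ν.withDensity w) (fun y => f y ^ r) x) →
      ∫⁻ x, w x * maximalFunction ν f x ^ q ∂ν ≤
        D ^ (q / r) * C * ∫⁻ x, w x * f x ^ q ∂ν := by
  obtain ⟨C, hC, hstrong⟩ := exists_lintegral_maximalFunction_rpow_le E ((one_lt_div hr).2 hrq)
  refine ⟨C, hC, fun w f D hw hf hD hpt => ?_⟩
  have hqr : 0 ≤ q / r := div_nonneg (hr.trans hrq).le hr.le
  have hpow : ∀ a : ℝ≥0∞, a ^ q = (a ^ r) ^ (q / r) := fun a => by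
    rw [← ENNReal.rpow_mul, mul_div_cancel₀ _ hr.ne']
  have hdens : ∀ u : E → ℝ≥0∞, Measurable u →
      ∫⁻ x, w x * u x ∂ν = ∫⁻ x, u x ∂ν.withDensity w := fun u hu =>
    (lintegral_withDensity_eq_lintegral_mul ν hw hu).symm
  rw [hdens _ ((measurable_maximalFunction ν f).pow_const q), hdens _ (hf.pow_const q)]
  calc ∫⁻ x, maximalFunction ν f x ^ q ∂ν.withDensity w
      ≤ ∫⁻ x, D ^ (q / r) * maximalFunction (ν.withDensity w) (fun y => f y ^ r) x ^ (q / r)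
          ∂ν.withDensity w := by
        refine lintegral_mono fun x => ?_
        simp only
        rw [hpow, ← ENNReal.mul_rpow_of_nonneg _ _ hqr]
        exact ENNReal.rpow_le_rpow (hpt x) hqr
    _ = D ^ (q / r) * ∫⁻ x, maximalFunction (ν.withDensity w) (fun y => f y ^ r) x ^ (q / r)
          ∂ν.withDensity w := lintegral_const_mul' _ _ (by finiteness)
    _ ≤ D ^ (q / r) * (C * ∫⁻ x, (f x ^ r) ^ (q / r) ∂ν.withDensity w) :=
        mul_le_mul_right (hstrong _ _ (hf.pow_const r)) _
    _ = _ := by simp_rw [← hpow, mul_assoc]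

theorem average_le_of_maximalFunction_le (hA : ∀ x, maximalFunction ν h x ≤ A * h x) {x y : E}
    {ρ : ℝ} (hy : y ∈ ball x ρ) :
    (ν (ball x ρ))⁻¹ * ∫⁻ z in ball x ρ, h z ∂ν ≤ 2 ^ Module.finrank ℝ E * A * h y := by
  rw [mul_assoc]
  exact (average_le_mul_maximalFunction_of_mem_ball ν h hy).trans (mul_le_mul_right (hA y) _)

theorem maximalFunction_le_withDensity (hm : Measurable h) (hAtop : A ≠ ∞)
    (hA : ∀ x, maximalFunction ν h x ≤ A * h x) (h0 : ∀ x, h x ≠ 0) (htop : ∀ᵐ x ∂ν, h x ≠ ∞)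
    {f : E → ℝ≥0∞} (hf : Measurable f) (x : E) :
    maximalFunction ν f x ≤
      2 ^ Module.finrank ℝ E * A * maximalFunction (ν.withDensity h) f x := by
  refine iSup₂_le fun ρ hρ => le_trans ?_
    (mul_le_mul_right (average_le_maximalFunction (μ := ν.withDensity h) f x hρ) _)
  rw [setLIntegral_withDensity_eq_setLIntegral_mul ν hm hf measurableSet_ball,
    withDensity_apply _ measurableSet_ball]
  have hball : ν (ball x ρ) ≠ ∞ := measure_ball_lt_top.ne
  set D : ℝ≥0∞ := 2 ^ Module.finrank ℝ E * A
  set W := ∫⁻ z in ball x ρ, h z ∂ν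
  have hW0 : W ≠ 0 := setLIntegral_ball_ne_zero hm x hρ (.of_forall h0)
  have hWtop : W ≠ ∞ := by
    obtain ⟨y, hy, hytop⟩ := exists_mem_ball_of_ae htop x hρ
    intro hW
    have h1 := average_le_of_maximalFunction_le hA hy
    change (ν (ball x ρ))⁻¹ * W ≤ D * h y at h1
    rw [hW, ENNReal.mul_top (ENNReal.inv_ne_zero.2 hball), top_le_iff] at h1
    exact ENNReal.mul_ne_top (by finiteness) hytop h1
  calc (ν (ball x ρ))⁻¹ * ∫⁻ y in ball x ρ, f y ∂ν
      = W⁻¹ * ∫⁻ y in ball x ρ, ((ν (ball x ρ))⁻¹ * W) * f y ∂ν := by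
        rw [lintegral_const_mul _ hf, mul_comm _ W, ← mul_assoc, ← mul_assoc,
          ENNReal.inv_mul_cancel hW0 hWtop, one_mul]
    _ ≤ W⁻¹ * ∫⁻ y in ball x ρ, D * (h y * f y) ∂ν := by
        refine mul_le_mul_right (setLIntegral_mono' measurableSet_ball fun y hy => ?_) _
        rw [← mul_assoc]
        exact mul_le_mul_left (average_le_of_maximalFunction_le hA hy) _
    _ = D * (W⁻¹ * ∫⁻ y in ball x ρ, (h * f) y ∂ν) := by
        rw [lintegral_const_mul _ (by fun_prop), mul_left_comm]; rfl

theorem maximalFunction_rpow_le_withDensity {r : ℝ} (hr : 1 < r) (hm : Measurable h)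
    (hAtop : A ≠ ∞)
    (hA : ∀ x, maximalFunction ν h x ≤ A * h x) (h0 : ∀ x, h x ≠ 0) (htop : ∀ᵐ x ∂ν, h x ≠ ∞)
    {f : E → ℝ≥0∞} (hf : Measurable f) (x : E) :
    maximalFunction ν f x ^ r ≤ (2 ^ Module.finrank ℝ E * A) ^ (r - 1) *
      maximalFunction (ν.withDensity fun y => h y ^ (1 - r)) (fun y => f y ^ r) x := by
  have hr0 : 0 < r := by linarith
  have hw : Measurable fun y => h y ^ (1 - r) := hm.pow_const _
  rw [← ENNReal.le_rpow_inv_iff hr0]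
  refine iSup₂_le fun ρ hρ => ?_
  rw [ENNReal.le_rpow_inv_iff hr0]
  refine le_trans ?_ (mul_le_mul_right (average_le_maximalFunction
    (μ := ν.withDensity fun y => h y ^ (1 - r)) (fun y => f y ^ r) x hρ) _)
  rw [setLIntegral_withDensity_eq_setLIntegral_mul ν hw (hf.pow_const r) measurableSet_ball,
    withDensity_apply _ measurableSet_ball]
  have hV : ν (ball x ρ) ≠ ∞ := measure_ball_lt_top.ne
  have hV0 : ν (ball x ρ) ≠ 0 := (measure_ball_pos ν x hρ).ne'
  have hDtop : 2 ^ Module.finrank ℝ E * A ≠ ∞ := by finiteness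
  have hAv := fun y (hy : y ∈ ball x ρ) => average_le_of_maximalFunction_le hA hy
  have hI0 : ∫⁻ z in ball x ρ, h z ∂ν ≠ 0 :=
    setLIntegral_ball_ne_zero hm x hρ (.of_forall h0)
  set V := ν (ball x ρ)
  set D : ℝ≥0∞ := 2 ^ Module.finrank ℝ E * A
  set m := V⁻¹ * ∫⁻ z in ball x ρ, h z ∂ν with hm_def
  have hm0 : m ≠ 0 := mul_ne_zero (ENNReal.inv_ne_zero.2 hV) hI0
  have hIm : ∫⁻ z in ball x ρ, h z ∂ν = V * m := by
    rw [hm_def, ← mul_assoc, ENNReal.mul_inv_cancel hV0 hV, one_mul]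
  set W := ∫⁻ y in ball x ρ, h y ^ (1 - r) ∂ν
  set J := ∫⁻ y in ball x ρ, ((fun y => h y ^ (1 - r)) * fun y => f y ^ r) y ∂ν with hJ
  have hmW : m ^ (r - 1) * W ≤ D ^ (r - 1) * V := by
    calc m ^ (r - 1) * W = ∫⁻ y in ball x ρ, m ^ (r - 1) * h y ^ (1 - r) ∂ν :=
          (lintegral_const_mul _ hw).symm
      _ ≤ ∫⁻ y in ball x ρ, D ^ (r - 1) ∂ν := by
          refine setLIntegral_mono' measurableSet_ball fun y hy => ?_
          calc m ^ (r - 1) * h y ^ (1 - r) ≤ (D * h y) ^ (r - 1) * h y ^ (1 - r) := by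
                exact mul_le_mul_left (ENNReal.rpow_le_rpow (hAv y hy) (by linarith)) _
            _ = D ^ (r - 1) * (h y ^ (r - 1) * (h y ^ (r - 1))⁻¹) := by
                rw [ENNReal.mul_rpow_of_nonneg _ _ (by linarith), mul_assoc, ← ENNReal.rpow_neg,
                  neg_sub]
            _ ≤ D ^ (r - 1) := mul_le_of_le_one_right' (ENNReal.mul_inv_le_one _)
      _ = D ^ (r - 1) * V := setLIntegral_const _ _
  have hW0 : W ≠ 0 := by
    refine setLIntegral_ball_ne_zero hw x hρ (htop.mono fun y hy => ?_)
    exact (ENNReal.rpow_pos (pos_iff_ne_zero.2 (h0 y)) hy).ne'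
  have hWtop : W ≠ ∞ := by
    intro hW
    rw [hW, ENNReal.mul_top, top_le_iff] at hmW
    · exact ENNReal.mul_ne_top
        (ENNReal.rpow_ne_top_of_nonneg (by linarith) hDtop) hV hmW
    · simp only [Ne, ENNReal.rpow_eq_zero_iff, not_or]
      exact ⟨fun h => hm0 h.1, fun h => by linarith [h.2]⟩
  have hVm : V⁻¹ * m ^ (r - 1) ≤ D ^ (r - 1) * W⁻¹ := by
    calc V⁻¹ * m ^ (r - 1) = V⁻¹ * (m ^ (r - 1) * W * W⁻¹) := by
          rw [mul_assoc (m ^ (r - 1)), ENNReal.mul_inv_cancel hW0 hWtop, mul_one]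
      _ ≤ V⁻¹ * (D ^ (r - 1) * V * W⁻¹) := by gcongr
      _ = (V⁻¹ * V) * (D ^ (r - 1) * W⁻¹) := by ring
      _ = D ^ (r - 1) * W⁻¹ := by rw [ENNReal.inv_mul_cancel hV0 hV, one_mul]
  have hholder : ∫⁻ y in ball x ρ, f y ∂ν ≤ J ^ r⁻¹ * (V * m) ^ (1 - r⁻¹) := by
    rw [← hIm]
    refine le_trans (le_of_eq (lintegral_congr_ae (ae_restrict_of_ae ?_)))
      (ENNReal.lintegral_mul_norm_pow_le (hw.mul (hf.pow_const r)).aemeasurable hm.aemeasurable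
        (inv_nonneg.2 hr0.le) (sub_nonneg.2 (inv_le_one_of_one_le₀ hr.le)) (by ring))
    filter_upwards [htop] with y hy
    simp only [Pi.mul_apply]
    rw [ENNReal.mul_rpow_of_nonneg _ _ (inv_nonneg.2 hr0.le), ENNReal.rpow_rpow_inv hr0.ne',
      ← ENNReal.rpow_mul, mul_right_comm, ← ENNReal.rpow_add _ _ (h0 y) hy]
    rw [show (1 - r) * r⁻¹ + (1 - r⁻¹) = 0 by field_simp; ring, ENNReal.rpow_zero, one_mul]
  calc (V⁻¹ * ∫⁻ y in ball x ρ, f y ∂ν) ^ r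
      ≤ (V⁻¹ * (J ^ r⁻¹ * (V * m) ^ (1 - r⁻¹))) ^ r := by gcongr
    _ = V⁻¹ * m ^ (r - 1) * J := by
        rw [ENNReal.mul_rpow_of_nonneg _ _ hr0.le, ENNReal.mul_rpow_of_nonneg _ _ hr0.le,
          ENNReal.rpow_inv_rpow hr0.ne', ← ENNReal.rpow_mul,
          show (1 - r⁻¹) * r = r - 1 by field_simp,
          ENNReal.mul_rpow_of_nonneg _ _ (by linarith), ENNReal.inv_rpow, ← ENNReal.rpow_neg,
          ← ENNReal.rpow_neg_one V, show (-1 : ℝ) = -r + (r - 1) by ring,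
          ENNReal.rpow_add _ _ hV0 hV]
        ring
    _ ≤ D ^ (r - 1) * W⁻¹ * J := by gcongr
    _ = D ^ (r - 1) * (W⁻¹ * J) := mul_assoc _ _ _

theorem exists_lintegral_mul_maximalFunction_rpow_le (ν : Measure E) [ν.IsAddHaarMeasure] {q : ℝ}
    (hq : 1 < q) {A : ℝ≥0∞} (hAtop : A ≠ ∞) :
    ∃ C : ℝ≥0∞, C ≠ ∞ ∧ ∀ h : E → ℝ≥0∞, Measurable h →
      (∀ x, maximalFunction ν h x ≤ A * h x) → (∀ x, h x ≠ 0) → (∀ᵐ x ∂ν, h x ≠ ∞) →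
      ∀ f : E → ℝ≥0∞, Measurable f →
        ∫⁻ x, h x * maximalFunction ν f x ^ q ∂ν ≤ C * ∫⁻ x, h x * f x ^ q ∂ν := by
  obtain ⟨C, hC, H⟩ := exists_lintegral_mul_maximalFunction_rpow_le_of_pointwise ν one_pos hq
  refine ⟨(2 ^ Module.finrank ℝ E * A) ^ (q / 1) * C, ?_, fun h hm hA h0 htop f hf =>
    H h f _ hm hf (by finiteness) fun x => ?_⟩
  · exact ENNReal.mul_ne_top (ENNReal.rpow_ne_top_of_nonneg (by positivity) (by finiteness)) hC
  · simpa using maximalFunction_le_withDensity hm hAtop hA h0 htop hf x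

theorem exists_lintegral_rpow_mul_maximalFunction_rpow_le (ν : Measure E) [ν.IsAddHaarMeasure]
    {r q : ℝ} (hr : 1 < r) (hrq : r < q) {A : ℝ≥0∞} (hAtop : A ≠ ∞) :
    ∃ C : ℝ≥0∞, C ≠ ∞ ∧ ∀ h : E → ℝ≥0∞, Measurable h →
      (∀ x, maximalFunction ν h x ≤ A * h x) → (∀ x, h x ≠ 0) → (∀ᵐ x ∂ν, h x ≠ ∞) →
      ∀ f : E → ℝ≥0∞, Measurable f →
        ∫⁻ x, h x ^ (1 - r) * maximalFunction ν f x ^ q ∂ν ≤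
          C * ∫⁻ x, h x ^ (1 - r) * f x ^ q ∂ν := by
  have hr0 : 0 < r := by linarith
  obtain ⟨C, hC, H⟩ := exists_lintegral_mul_maximalFunction_rpow_le_of_pointwise ν hr0 hrq
  have hD : ((2 : ℝ≥0∞) ^ Module.finrank ℝ E * A) ^ (r - 1) ≠ ∞ :=
    ENNReal.rpow_ne_top_of_nonneg (by linarith) (by finiteness)
  refine ⟨((2 ^ Module.finrank ℝ E * A) ^ (r - 1)) ^ (q / r) * C, ?_, fun h hm hA h0 htop f hf =>
    H _ f _ (hm.pow_const _) hf hD fun x =>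
      maximalFunction_rpow_le_withDensity hr hm hAtop hA h0 htop hf x⟩
  exact ENNReal.mul_ne_top
    (ENNReal.rpow_ne_top_of_nonneg (div_nonneg (hr0.trans hrq).le hr0.le) hD) hC

end Weights

section VectorValued

variable {ι : Type*} [Countable ι]

theorem exists_lintegral_tsum_maximalFunction_rpow_le_of_lt {p q : ℝ} (hp : 1 < p) (hpq : p < q) :
    ∃ C : ℝ≥0∞, C ≠ ∞ ∧ ∀ f : ι → E → ℝ≥0∞, (∀ j, Measurable (f j)) →
      ∫⁻ x, (∑' j, maximalFunction ν (f j) x ^ q) ^ (p / q) ∂ν ≤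
        C * ∫⁻ x, (∑' j, f j x ^ q) ^ (p / q) ∂ν := by
  have hp0 : 0 < p := by linarith
  have hq0 : 0 < q := by linarith
  obtain ⟨A, K, hAtop, hK, hmaj⟩ := exists_majorant_maximalFunction_le ν hp
  obtain ⟨C, hC, hweight⟩ := exists_lintegral_rpow_mul_maximalFunction_rpow_le ν
    (r := q - p + 1) (by linarith) (by linarith : q - p + 1 < q) hAtop
  have hpq0 : 0 ≤ p / q := by positivity
  have hpq1 : 0 ≤ 1 - p / q := sub_nonneg.2 ((div_le_one hq0).2 hpq.le)
  refine ⟨(C ^ (p / q) * K) + 1, by finiteness, fun f hf => ?_⟩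
  set F : E → ℝ≥0∞ := fun x => ∑' j, f j x ^ q
  set G : E → ℝ≥0∞ := fun x => ∑' j, maximalFunction ν (f j) x ^ q
  have hF : Measurable F := Measurable.tsum fun j => (hf j).pow_const q
  have hG : Measurable G :=
    Measurable.tsum fun j => (measurable_maximalFunction ν (f j)).pow_const q
  change ∫⁻ x, G x ^ (p / q) ∂ν ≤ (C ^ (p / q) * K + 1) * ∫⁻ x, F x ^ (p / q) ∂ν
  obtain ⟨h, hm, hFh, hA, hnorm⟩ := hmaj (fun x => F x ^ q⁻¹) (hF.pow_const _)
  simp_rw [← ENNReal.rpow_mul, inv_mul_eq_div] at hnorm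
  set X := ∫⁻ x, F x ^ (p / q) ∂ν
  rcases eq_or_ne X ∞ with hX | hX
  · rw [hX, ENNReal.mul_top (by simp)]
    exact le_top
  have hhtop : ∀ᵐ x ∂ν, h x ≠ ∞ := by
    filter_upwards [ae_lt_top (hm.pow_const p)
      (ne_top_of_le_ne_top (ENNReal.mul_ne_top hK hX) hnorm)] with x hx hx'
    rw [hx', ENNReal.top_rpow_of_pos hp0] at hx
    exact hx.ne rfl
  rcases ae_eq_zero_or_forall_ne_zero_of_maximalFunction_le hm hA with hz | h0
  · have hfz : ∀ j, f j =ᵐ[ν] 0 := by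
      intro j
      filter_upwards [hz] with x hx
      have h1 : F x ^ q⁻¹ = 0 := le_antisymm (by simpa [hx] using hFh x) zero_le
      have h2 : F x = 0 := (ENNReal.rpow_eq_zero_iff_of_pos (inv_pos.2 hq0)).1 h1
      exact (ENNReal.rpow_eq_zero_iff_of_pos hq0).1 (ENNReal.tsum_eq_zero.1 h2 j)
    have hMz : ∀ j x, maximalFunction ν (f j) x = 0 := by
      intro j x
      simp [maximalFunction, lintegral_congr_ae (ae_restrict_of_ae (hfz j))]
    have hGz : ∀ x, G x = 0 := fun x => by simp [G, hMz, hq0]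
    simp [hGz, div_pos hp0 hq0]
  have hvec := lintegral_mul_tsum_maximalFunction_le (hm.pow_const _)
    (hweight h hm hA h0 hhtop) hf
  simp_rw [show 1 - (q - p + 1) = p - q by ring] at hvec
  change ∫⁻ x, h x ^ (p - q) * G x ∂ν ≤ C * ∫⁻ x, h x ^ (p - q) * F x ∂ν at hvec
  have hFle : ∫⁻ x, h x ^ (p - q) * F x ∂ν ≤ ∫⁻ x, h x ^ p ∂ν := by
    refine lintegral_mono_ae ?_
    filter_upwards [hhtop] with x hx
    calc h x ^ (p - q) * F x ≤ h x ^ (p - q) * h x ^ q :=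
          mul_le_mul_right ((ENNReal.rpow_inv_le_iff hq0).1 (hFh x)) _
      _ = h x ^ p := by rw [← ENNReal.rpow_add _ _ (h0 x) hx, sub_add_cancel]
  calc ∫⁻ x, G x ^ (p / q) ∂ν
      = ∫⁻ x, (h x ^ (p - q) * G x) ^ (p / q) * (h x ^ p) ^ (1 - p / q) ∂ν := by
        refine lintegral_congr_ae ?_
        filter_upwards [hhtop] with x hx
        rw [ENNReal.mul_rpow_of_nonneg _ _ hpq0, ← ENNReal.rpow_mul, ← ENNReal.rpow_mul,
          mul_right_comm, ← ENNReal.rpow_add _ _ (h0 x) hx,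
          show (p - q) * (p / q) + p * (1 - p / q) = 0 by field_simp; ring, ENNReal.rpow_zero,
          one_mul]
    _ ≤ (∫⁻ x, h x ^ (p - q) * G x ∂ν) ^ (p / q) * (∫⁻ x, h x ^ p ∂ν) ^ (1 - p / q) :=
        ENNReal.lintegral_mul_norm_pow_le ((hm.pow_const _).mul hG).aemeasurable
          (hm.pow_const _).aemeasurable hpq0 hpq1 (by ring)
    _ ≤ (C * (K * X)) ^ (p / q) * (K * X) ^ (1 - p / q) := by
        gcongr
        exact hvec.trans (mul_le_mul_right (hFle.trans hnorm) _)
    _ = C ^ (p / q) * K * X := by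
        rw [ENNReal.mul_rpow_of_nonneg _ _ hpq0, mul_assoc,
          ← ENNReal.rpow_add_of_nonneg _ _ hpq0 hpq1, add_sub_cancel, ENNReal.rpow_one, mul_assoc]
    _ ≤ (C ^ (p / q) * K + 1) * X := by gcongr; exact le_self_add

theorem exists_lintegral_tsum_maximalFunction_rpow_le_of_gt {p q : ℝ} (hq : 1 < q) (hpq : q < p) :
    ∃ C : ℝ≥0∞, C ≠ ∞ ∧ ∀ f : ι → E → ℝ≥0∞, (∀ j, Measurable (f j)) →
      ∫⁻ x, (∑' j, maximalFunction ν (f j) x ^ q) ^ (p / q) ∂ν ≤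
        C * ∫⁻ x, (∑' j, f j x ^ q) ^ (p / q) ∂ν := by
  have hq0 : 0 < q := by linarith
  have ha : 1 < p / q := (one_lt_div hq0).2 hpq
  set a := p / q
  have ha0 : 0 < a := by linarith
  have hconj := Real.HolderConjugate.conjExponent ha
  set a' := a.conjExponent
  obtain ⟨A, K, hAtop, hK, hmaj⟩ := exists_majorant_maximalFunction_le ν hconj.symm.lt
  obtain ⟨C, hC, hweight⟩ := exists_lintegral_mul_maximalFunction_rpow_le ν hq hAtop
  have hL : C * K ^ (1 / a') ≠ ∞ := ENNReal.mul_ne_top hC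
    (ENNReal.rpow_ne_top_of_nonneg (one_div_nonneg.2 hconj.symm.nonneg) hK)
  refine ⟨(C * K ^ (1 / a')) ^ a, ENNReal.rpow_ne_top_of_nonneg ha0.le hL, fun f hf => ?_⟩
  set F : E → ℝ≥0∞ := fun x => ∑' j, f j x ^ q
  set G : E → ℝ≥0∞ := fun x => ∑' j, maximalFunction ν (f j) x ^ q
  have hF : Measurable F := Measurable.tsum fun j => (hf j).pow_const q
  have hG : Measurable G :=
    Measurable.tsum fun j => (measurable_maximalFunction ν (f j)).pow_const q
  change ∫⁻ x, G x ^ a ∂ν ≤ (C * K ^ (1 / a')) ^ a * ∫⁻ x, F x ^ a ∂ν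
  set X := ∫⁻ x, F x ^ a ∂ν
  refine lintegral_le_of_forall_le_of_ne_top (hG.pow_const a) fun g hg hgG hgtop => ?_
  set Y := ∫⁻ x, g x ∂ν
  rcases eq_or_ne Y 0 with hY0 | hY0
  · simp [hY0]
  obtain ⟨h, hm, hgh, hA, hnorm⟩ := hmaj (fun x => g x ^ (1 / a')) (hg.pow_const _)
  have hpow : ∀ t : ℝ≥0∞, (t ^ (1 / a')) ^ a' = t := fun t => by
    rw [one_div, ENNReal.rpow_inv_rpow hconj.symm.pos.ne']
  simp_rw [hpow] at hnorm
  have hhtop : ∀ᵐ x ∂ν, h x ≠ ∞ := by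
    filter_upwards [ae_lt_top (hm.pow_const a')
      (ne_top_of_le_ne_top (ENNReal.mul_ne_top hK hgtop) hnorm)] with x hx hx'
    rw [hx', ENNReal.top_rpow_of_pos hconj.symm.pos] at hx
    exact hx.ne rfl
  rcases ae_eq_zero_or_forall_ne_zero_of_maximalFunction_le hm hA with hz | h0
  · refine absurd ((lintegral_eq_zero_iff hg).2 ?_) hY0
    filter_upwards [hz] with x hx
    have h1 : g x ^ (1 / a') = 0 := le_antisymm (by simpa [hx] using hgh x) zero_le
    exact (ENNReal.rpow_eq_zero_iff_of_pos (one_div_pos.2 hconj.symm.pos)).1 h1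
  have hsum : 1 / a + 1 / a' = 1 := by
    simpa only [one_div] using hconj.inv_add_inv_eq_one
  have hvec := lintegral_mul_tsum_maximalFunction_le hm (hweight h hm hA h0 hhtop) hf
  change ∫⁻ x, h x * G x ∂ν ≤ C * ∫⁻ x, h x * F x ∂ν at hvec
  have hself : Y ≤ C * K ^ (1 / a') * X ^ (1 / a) * Y ^ (1 / a') := by
    calc Y ≤ ∫⁻ x, h x * G x ∂ν := by
          refine lintegral_mono fun x => ?_
          calc g x = g x ^ (1 / a') * g x ^ (1 / a) := by
                rw [← ENNReal.rpow_add_of_nonneg _ _ (one_div_nonneg.2 hconj.symm.nonneg)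
                  (one_div_nonneg.2 ha0.le), add_comm, hsum, ENNReal.rpow_one]
            _ ≤ h x * G x := by
                refine mul_le_mul' (hgh x) ?_
                rw [one_div, ENNReal.rpow_inv_le_iff ha0]
                exact hgG x
      _ ≤ C * ∫⁻ x, h x * F x ∂ν := hvec
      _ ≤ C * ((∫⁻ x, h x ^ a' ∂ν) ^ (1 / a') * X ^ (1 / a)) :=
          mul_le_mul_right (ENNReal.lintegral_mul_le_Lp_mul_Lq ν hconj.symm hm.aemeasurable
            hF.aemeasurable) _
      _ ≤ C * ((K * Y) ^ (1 / a') * X ^ (1 / a)) := by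
          have := ENNReal.rpow_le_rpow hnorm (one_div_nonneg.2 hconj.symm.nonneg)
          gcongr
      _ = _ := by
          rw [ENNReal.mul_rpow_of_nonneg _ _ (one_div_nonneg.2 hconj.symm.nonneg)]; ring
  have hYp0 : Y ^ (1 / a') ≠ 0 := (ENNReal.rpow_pos (pos_iff_ne_zero.2 hY0) hgtop).ne'
  have hYp : Y ^ (1 / a') ≠ ∞ :=
    ENNReal.rpow_ne_top_of_nonneg (one_div_nonneg.2 hconj.symm.nonneg) hgtop
  have hsplit : Y = Y ^ (1 / a) * Y ^ (1 / a') := by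
    rw [← ENNReal.rpow_add _ _ hY0 hgtop, hsum, ENNReal.rpow_one]
  have hroot : Y ^ (1 / a) ≤ C * K ^ (1 / a') * X ^ (1 / a) := by
    rw [← ENNReal.mul_le_mul_iff_left hYp0 hYp, ← hsplit]
    exact hself
  calc Y = (Y ^ (1 / a)) ^ a := by rw [one_div, ENNReal.rpow_inv_rpow ha0.ne']
    _ ≤ (C * K ^ (1 / a') * X ^ (1 / a)) ^ a := ENNReal.rpow_le_rpow hroot ha0.le
    _ = (C * K ^ (1 / a')) ^ a * X := by
        rw [ENNReal.mul_rpow_of_nonneg _ _ ha0.le, one_div a, ENNReal.rpow_inv_rpow ha0.ne']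

theorem exists_lintegral_tsum_maximalFunction_rpow_le {p q : ℝ} (hp : 1 < p) (hq : 1 < q) :
    ∃ C : ℝ≥0∞, C ≠ ∞ ∧ ∀ f : ι → E → ℝ≥0∞, (∀ j, Measurable (f j)) →
      ∫⁻ x, (∑' j, maximalFunction ν (f j) x ^ q) ^ (p / q) ∂ν ≤
        C * ∫⁻ x, (∑' j, f j x ^ q) ^ (p / q) ∂ν := by
  rcases lt_trichotomy p q with h | rfl | h
  · exact exists_lintegral_tsum_maximalFunction_rpow_le_of_lt ν hp h
  · obtain ⟨C, hC, H⟩ := exists_lintegral_maximalFunction_rpow_le E hp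
    refine ⟨C, hC, fun f hf => ?_⟩
    have := lintegral_mul_tsum_maximalFunction_le (ν := ν) (w := 1) measurable_one (q := p)
      (C := C) (fun f hf => by simpa using H ν f hf) hf
    simpa [div_self (by linarith : p ≠ 0)] using this
  · exact exists_lintegral_tsum_maximalFunction_rpow_le_of_gt ν hq h

end VectorValued

end Haar

end MaximalFunction

/-- Lemma 2.3(b), the Fefferman–Stein vector-valued maximal inequality:
for `1 < p < ∞` and `1 < q ≤ ∞` there is `C = C(n,p,q)` with
`‖(Σ_j (M f_j)^q)^{1/q}‖_p ≤ C ‖(Σ_j |f_j|^q)^{1/q}‖_p` for every sequence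
`(f_j)_{j∈ℤ}` of measurable functions on `ℝⁿ`. -/
theorem fefferman_stein_vector_valued_maximal_inequality
    (n : ℕ) (hn : 1 ≤ n) (p : ℝ) (q : ℝ≥0∞) (hp : 1 < p) (hq : 1 < q) :
    ∃ C > (0 : ℝ), ∀ f : ℤ → EuclideanSpace ℝ (Fin n) → ℂ,
      (∀ j, Measurable (f j)) →
      (∫⁻ x, (lqNormZ q (fun j => hlMax (fun y => ‖f j y‖) x)) ^ p ∂volume) ^ (1 / p)
        ≤ ENNReal.ofReal C *
          (∫⁻ x, (lqNormZ q (fun j => ENNReal.ofReal ‖f j x‖)) ^ p ∂volume) ^ (1 / p) := by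
  have key : ∃ C : ℝ≥0∞, C ≠ ∞ ∧ ∀ f : ℤ → EuclideanSpace ℝ (Fin n) → ℝ≥0∞,
      (∀ j, Measurable (f j)) →
      ∫⁻ x, (lqNormZ q fun j => maximalFunction volume (f j) x) ^ p ≤
        C * ∫⁻ x, (lqNormZ q fun j => f j x) ^ p := by
    rcases eq_or_ne q ∞ with rfl | hqtop
    · obtain ⟨C, hC, H⟩ :=
        exists_lintegral_maximalFunction_rpow_le (EuclideanSpace ℝ (Fin n)) hp
      refine ⟨C, hC, fun f hf => ?_⟩
      simp only [lqNormZ, if_true]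
      refine le_trans (lintegral_mono fun x => ?_) (H volume _ (Measurable.iSup hf))
      exact ENNReal.rpow_le_rpow (iSup_le fun j =>
        maximalFunction_mono (fun y => le_iSup (fun j => f j y) j) x) (by linarith)
    · have hq1 : 1 < q.toReal := by
        rwa [← ENNReal.toReal_one, ENNReal.toReal_lt_toReal one_ne_top hqtop]
      obtain ⟨C, hC, H⟩ := exists_lintegral_tsum_maximalFunction_rpow_le (ι := ℤ)
        (volume : Measure (EuclideanSpace ℝ (Fin n))) hp hq1
      refine ⟨C, hC, fun f hf => ?_⟩
      simp only [lqNormZ, hqtop, if_false, ← ENNReal.rpow_mul, one_div_mul_eq_div]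
      exact H f hf
  obtain ⟨C, hC, H⟩ := key
  have hp' : 0 ≤ 1 / p := one_div_nonneg.2 (by linarith)
  refine ⟨(C ^ (1 / p)).toReal + 1, by positivity, fun f hf => ?_⟩
  have hle : C ^ (1 / p) ≤ ENNReal.ofReal ((C ^ (1 / p)).toReal + 1) :=
    (ENNReal.ofReal_toReal (ENNReal.rpow_ne_top_of_nonneg hp' hC)).symm.le.trans
      (ENNReal.ofReal_le_ofReal (by linarith))
  have hmax : ∀ j x, hlMax (fun y => ‖f j y‖) x =
      maximalFunction volume (fun y => ENNReal.ofReal ‖f j y‖) x := fun j x => by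
    simp only [hlMax, maximalFunction, abs_norm]
  simp_rw [hmax]
  calc _ ≤ (C * ∫⁻ x, (lqNormZ q fun j => ENNReal.ofReal ‖f j x‖) ^ p) ^ (1 / p) :=
        ENNReal.rpow_le_rpow (H _ fun j => (hf j).norm.ennreal_ofReal) hp'
    _ ≤ _ := by
        rw [ENNReal.mul_rpow_of_nonneg _ _ hp']
        exact mul_le_mul_left hle _
end

section
/- Let h_k (k ∈ ℕ₀) denote the L²-normalized Hermite functions on ℝ, h_k(x) = (2^k k! √π)^{−1/2} H_k(x) e^{−x²/2}, where H_k(x) = (−1)^k e^{x²} (d/dx)^k e^{−x²} is the k-th (physicists') Hermite polynomial. Then for every t > 0 and all x, y ∈ ℝ the series Σ_{k=0}^∞ e^{−(2k+1)t} h_k(x) h_k(y) converges absolutely and Σ_{k=0}^∞ e^{−(2k+1)t} h_k(x) h_k(y) = (2π sinh(2t))^{−1/2} exp( −(1/2) coth(2t)(x² + y²) + x y / sinh(2t) ). (Mehler's formula in dimension one, giving the heat kernel of the Hermite operator H = −d²/dx² + x².) -/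
open Real

/-- The `k`-th physicists' Hermite polynomial (as a function),
`H_k(x) = (−1)^k e^{x²} (d/dx)^k e^{−x²}`. -/
noncomputable def hermitePoly (k : ℕ) (x : ℝ) : ℝ :=
  (-1 : ℝ) ^ k * Real.exp (x ^ 2) * iteratedDeriv k (fun u => Real.exp (-u ^ 2)) x

/-- The `k`-th `L²`-normalized Hermite function
`h_k(x) = (2^k k! √π)^{−1/2} H_k(x) e^{−x²/2}`. -/
noncomputable def hermiteFun (k : ℕ) (x : ℝ) : ℝ :=
  ((2 : ℝ) ^ k * (Nat.factorial k) * Real.sqrt π) ^ (-(1 : ℝ) / 2) *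
    hermitePoly k x * Real.exp (-x ^ 2 / 2)

open MeasureTheory FourierTransform

/-- Iterated derivatives of a smooth real function commute with the inclusion `ℝ → ℂ`. -/
lemma iteratedDeriv_ofReal_comp {f : ℝ → ℝ} (hf : ContDiff ℝ ⊤ f) (k : ℕ) :
    iteratedDeriv k (fun u => (f u : ℂ)) = fun u => ((iteratedDeriv k f u : ℝ) : ℂ) := by
  induction k with
  | zero => simp
  | succ k ih =>
    rw [iteratedDeriv_succ, ih, iteratedDeriv_succ]
    funext u
    have hd : DifferentiableAt ℝ (iteratedDeriv k f) u :=
      (hf.differentiable_iteratedDeriv k (by exact_mod_cast WithTop.coe_lt_top _)) u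
    exact hd.hasDerivAt.ofReal_comp.deriv

lemma integrable_pow_smul_gaussian (n : ℕ) :
    Integrable (fun u : ℝ => u ^ n • Complex.exp (-π * π * (u : ℂ) ^ 2)) := by
  have h := (integrable_rpow_mul_exp_neg_mul_sq (b := π * π) (by positivity)
    (s := n) (by linarith [n.cast_nonneg (α := ℝ)])).ofReal (𝕜 := ℂ)
  refine h.congr (Filter.Eventually.of_forall fun u => ?_)
  simp [Real.rpow_natCast]

/-- Fourier representation of the derivatives of the Gaussian `e^{-x²}`. -/
lemma iteratedDeriv_gaussian_eq_integral (k : ℕ) (x : ℝ) :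
    ((iteratedDeriv k (fun u => Real.exp (-u ^ 2)) x : ℝ) : ℂ) =
      (Real.sqrt π : ℂ) * ∫ u : ℝ, (-2 * π * Complex.I * u) ^ k *
        Complex.exp (-π ^ 2 * u ^ 2 - 2 * π * Complex.I * x * u) := by
  have hsqrt : (π : ℂ) ^ (1 / 2 : ℂ) = (Real.sqrt π : ℂ) := by
    rw [Real.sqrt_eq_rpow, Complex.ofReal_cpow pi_pos.le]
    norm_num
  have hsqrt_ne : (Real.sqrt π : ℂ) ≠ 0 := by
    exact_mod_cast (Real.sqrt_pos.2 pi_pos).ne'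
  have hpi : (π : ℂ) ≠ 0 := by exact_mod_cast pi_ne_zero
  have hfourier := fourier_gaussian_pi (b := (π : ℂ)) (by simpa using pi_pos)
  have hcoe : (fun u : ℝ => ((Real.exp (-u ^ 2) : ℝ) : ℂ)) =
      (Real.sqrt π : ℂ) • 𝓕 (fun u : ℝ => Complex.exp (-π * π * (u : ℂ) ^ 2)) := by
    rw [hfourier]
    funext u
    simp only [Pi.smul_apply, smul_eq_mul, hsqrt]
    push_cast
    field_simp
  have hsmooth : ContDiff ℝ ⊤ (fun u : ℝ => Real.exp (-u ^ 2)) := by fun_prop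
  rw [← congrFun (iteratedDeriv_ofReal_comp hsmooth k) x, hcoe, iteratedDeriv_const_smul_field,
    Real.iteratedDeriv_fourier (N := ⊤) (fun n _ => integrable_pow_smul_gaussian n) le_top,
    Real.fourier_real_eq_integral_exp_smul, smul_eq_mul]
  congr 2
  funext u
  rw [smul_eq_mul, smul_eq_mul, mul_left_comm, ← Complex.exp_add]
  congr 2
  push_cast
  ring

lemma integral_integral_cexp_mehler {r : ℝ} (hr : |r| < 1) (x y : ℝ) :
    ∫ u : ℝ, ∫ v : ℝ, Complex.exp (-2 * π ^ 2 * r * u * v) *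
        (Complex.exp (-π ^ 2 * u ^ 2 - 2 * π * Complex.I * x * u) *
          Complex.exp (-π ^ 2 * v ^ 2 - 2 * π * Complex.I * y * v)) =
      (((π * Real.sqrt (1 - r ^ 2))⁻¹ *
        Real.exp (-(x ^ 2 + y ^ 2 - 2 * r * x * y) / (1 - r ^ 2)) : ℝ) : ℂ) := by
  have hr2 : 0 < 1 - r ^ 2 := by
    have := (sq_lt_one_iff_abs_lt_one r).2 hr
    linarith
  have hr2c : (1 - (r : ℂ) ^ 2) ≠ 0 := by exact_mod_cast hr2.ne'
  have hpi : (π : ℂ) ≠ 0 := by exact_mod_cast pi_ne_zero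
  have hcpow {a : ℝ} (ha : 0 ≤ a) : (a : ℂ) ^ (1 / 2 : ℂ) = (Real.sqrt a : ℂ) := by
    rw [Real.sqrt_eq_rpow, Complex.ofReal_cpow ha]
    norm_num
  have hinner (u : ℝ) : ∫ v : ℝ, Complex.exp (-2 * π ^ 2 * r * u * v) *
        (Complex.exp (-π ^ 2 * u ^ 2 - 2 * π * Complex.I * x * u) *
          Complex.exp (-π ^ 2 * v ^ 2 - 2 * π * Complex.I * y * v)) =
      (π / π ^ 2 : ℂ) ^ (1 / 2 : ℂ) * Complex.exp (-(π ^ 2 * (1 - r ^ 2)) * u ^ 2 +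
        (2 * π * Complex.I * (r * y - x)) * u + -y ^ 2) := by
    have h := integral_cexp_quadratic (b := -(π : ℂ) ^ 2)
      (by
        rw [← Complex.ofReal_pow, ← Complex.ofReal_neg, Complex.ofReal_re]
        exact neg_lt_zero.2 (by positivity))
      (-2 * π ^ 2 * r * u - 2 * π * Complex.I * y)
      (-π ^ 2 * u ^ 2 - 2 * π * Complex.I * x * u)
    rw [neg_neg] at h
    convert h using 2
    · funext v
      rw [← Complex.exp_add, ← Complex.exp_add]
      congr 1
      ring
    · congr 1
      field_simp
      ring_nf
      simp only [Complex.I_sq]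
      ring
  simp_rw [hinner, integral_const_mul]
  rw [integral_cexp_quadratic
    (by
      have : (-((π : ℂ) ^ 2 * (1 - (r : ℂ) ^ 2))) = ((-(π ^ 2 * (1 - r ^ 2)) : ℝ) : ℂ) := by
        push_cast; ring
      rw [this, Complex.ofReal_re]
      exact neg_lt_zero.2 (by positivity)), neg_neg]
  have h1 : (π / π ^ 2 : ℂ) ^ (1 / 2 : ℂ) = (Real.sqrt (π / π ^ 2) : ℂ) := by
    rw [← hcpow (by positivity)]; push_cast; rfl
  have h2 : (π / (π ^ 2 * (1 - r ^ 2)) : ℂ) ^ (1 / 2 : ℂ) =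
      (Real.sqrt (π / (π ^ 2 * (1 - r ^ 2))) : ℂ) := by
    rw [← hcpow (by positivity)]; push_cast; rfl
  have h3 : Real.sqrt (π / π ^ 2) * Real.sqrt (π / (π ^ 2 * (1 - r ^ 2))) =
      (π * Real.sqrt (1 - r ^ 2))⁻¹ := by
    rw [← Real.sqrt_mul (by positivity),
      show π / π ^ 2 * (π / (π ^ 2 * (1 - r ^ 2))) = ((π ^ 2) * (1 - r ^ 2))⁻¹ by field_simp,
      Real.sqrt_inv, Real.sqrt_mul (by positivity), Real.sqrt_sq pi_pos.le]
  rw [h1, h2, ← mul_assoc, ← Complex.ofReal_mul, h3, Complex.ofReal_mul, Complex.ofReal_exp]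
  congr 2
  push_cast
  field_simp
  ring_nf
  simp only [Complex.I_sq]
  ring

lemma norm_cexp_gaussian_phase (x u : ℝ) :
    ‖Complex.exp (-π ^ 2 * u ^ 2 - 2 * π * Complex.I * x * u)‖ = Real.exp (-π ^ 2 * u ^ 2) := by
  rw [Complex.norm_exp]
  congr 1
  rw [show (-π ^ 2 * u ^ 2 - 2 * π * Complex.I * x * u : ℂ) =
    ((-π ^ 2 * u ^ 2 : ℝ) : ℂ) + ((-2 * π * x * u : ℝ) : ℂ) * Complex.I by push_cast; ring]
  simp only [Complex.add_re, Complex.ofReal_re, Complex.re_ofReal_mul, Complex.I_re, mul_zero,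
    add_zero]

lemma integrable_exp_abs_mul_gaussian {r : ℝ} (hr : |r| < 1) :
    Integrable (fun p : ℝ × ℝ => Real.exp |2 * π ^ 2 * r * p.1 * p.2| *
      (Real.exp (-π ^ 2 * p.1 ^ 2) * Real.exp (-π ^ 2 * p.2 ^ 2))) := by
  have hb : 0 < π ^ 2 * (1 - |r|) := mul_pos (by positivity) (by linarith)
  refine ((integrable_exp_neg_mul_sq hb).mul_prod (integrable_exp_neg_mul_sq hb)).mono'
    (by fun_prop) (Filter.Eventually.of_forall fun p => ?_)
  rw [Real.norm_of_nonneg (by positivity), ← Real.exp_add, ← Real.exp_add, ← Real.exp_add,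
    Real.exp_le_exp]
  have habs : |2 * π ^ 2 * r * p.1 * p.2| = π ^ 2 * |r| * (2 * |p.1| * |p.2|) := by
    simp only [abs_mul, abs_pow, abs_of_pos pi_pos, abs_two]
    ring
  have hamgm := mul_le_mul_of_nonneg_left (two_mul_le_add_sq |p.1| |p.2|)
    (show 0 ≤ π ^ 2 * |r| by positivity)
  rw [sq_abs, sq_abs] at hamgm
  rw [habs]
  linarith

/-- Mehler's formula for the derivatives of the Gaussian. -/
lemma hasSum_iteratedDeriv_gaussian_mul {r : ℝ} (hr : |r| < 1) (x y : ℝ) :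
    HasSum (fun k : ℕ => (r / 2) ^ k / k.factorial *
        (iteratedDeriv k (fun u => Real.exp (-u ^ 2)) x *
          iteratedDeriv k (fun u => Real.exp (-u ^ 2)) y))
      ((Real.sqrt (1 - r ^ 2))⁻¹ *
        Real.exp (-(x ^ 2 + y ^ 2 - 2 * r * x * y) / (1 - r ^ 2))) := by
  let φ (x u : ℝ) : ℂ := Complex.exp (-π ^ 2 * u ^ 2 - 2 * π * Complex.I * x * u)
  have hφ (x u : ℝ) : ‖φ x u‖ = Real.exp (-π ^ 2 * u ^ 2) := norm_cexp_gaussian_phase x u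
  let F (k : ℕ) (p : ℝ × ℝ) : ℂ :=
    (-2 * π ^ 2 * r * p.1 * p.2) ^ k / k.factorial * (φ x p.1 * φ y p.2)
  let f (p : ℝ × ℝ) : ℂ := Complex.exp (-2 * π ^ 2 * r * p.1 * p.2) * (φ x p.1 * φ y p.2)
  let bound (k : ℕ) (p : ℝ × ℝ) : ℝ := |2 * π ^ 2 * r * p.1 * p.2| ^ k / k.factorial *
    (Real.exp (-π ^ 2 * p.1 ^ 2) * Real.exp (-π ^ 2 * p.2 ^ 2))
  have hnorm (p : ℝ × ℝ) :
      ‖(-2 * π ^ 2 * r * p.1 * p.2 : ℂ)‖ = |2 * π ^ 2 * r * p.1 * p.2| := by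
    rw [← Real.norm_eq_abs, ← Complex.norm_real, ← norm_neg]
    congr 1
    push_cast
    ring
  have hFbound (k : ℕ) (p : ℝ × ℝ) : ‖F k p‖ = bound k p := by
    simp only [F, bound, norm_mul, norm_div, norm_pow (_ : ℂ) k, hφ, Complex.norm_natCast]
    rw [← hnorm]
    simp only [norm_mul]
  have hbound (p : ℝ × ℝ) : HasSum (fun k => bound k p)
      (Real.exp |2 * π ^ 2 * r * p.1 * p.2| *
        (Real.exp (-π ^ 2 * p.1 ^ 2) * Real.exp (-π ^ 2 * p.2 ^ 2))) := by
    have h := NormedSpace.expSeries_div_hasSum_exp |2 * π ^ 2 * r * p.1 * p.2|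
    rw [← Real.exp_eq_exp_ℝ] at h
    exact h.mul_right _
  have hf (p : ℝ × ℝ) : HasSum (fun k => F k p) (f p) := by
    have h := NormedSpace.expSeries_div_hasSum_exp (-2 * π ^ 2 * r * p.1 * p.2 : ℂ)
    rw [← Complex.exp_eq_exp_ℂ] at h
    exact h.mul_right _
  have hFc (k : ℕ) : Continuous (F k) := by fun_prop
  have hfint : Integrable f := by
    refine (integrable_exp_abs_mul_gaussian hr).mono'
      (by fun_prop) (Filter.Eventually.of_forall fun p => ?_)
    simp only [f, norm_mul _ (φ x p.1 * φ y p.2), norm_mul (φ x p.1), hφ]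
    gcongr
    rw [← hnorm]
    exact Complex.norm_exp_le_exp_norm _
  have hsum := hasSum_integral_of_dominated_convergence (μ := volume) bound
    (fun k => (hFc k).aestronglyMeasurable)
    (fun k => Filter.Eventually.of_forall fun p => (hFbound k p).le)
    (Filter.Eventually.of_forall fun p => (hbound p).summable)
    (by simpa only [(hbound _).tsum_eq] using integrable_exp_abs_mul_gaussian hr)
    (Filter.Eventually.of_forall hf)
  have hF (k : ℕ) : (π : ℂ) * ∫ p, F k p = (((r / 2) ^ k / k.factorial *
        (iteratedDeriv k (fun u => Real.exp (-u ^ 2)) x *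
          iteratedDeriv k (fun u => Real.exp (-u ^ 2)) y) : ℝ) : ℂ) := by
    have hsplit (p : ℝ × ℝ) : F k p = ((r / 2) ^ k / k.factorial : ℂ) *
        (((-2 * π * Complex.I * p.1) ^ k * φ x p.1) *
          ((-2 * π * Complex.I * p.2) ^ k * φ y p.2)) := by
      have : (-2 * π ^ 2 * r * p.1 * p.2 : ℂ) =
          (r / 2) * (-2 * π * Complex.I * p.1) * (-2 * π * Complex.I * p.2) := by
        ring_nf
        simp only [Complex.I_sq]
        ring
      simp only [F]
      rw [this, mul_pow _ _ k, mul_pow _ _ k]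
      ring
    have hpi : (π : ℂ) = (Real.sqrt π : ℂ) * (Real.sqrt π : ℂ) := by
      rw [← Complex.ofReal_mul, Real.mul_self_sqrt pi_pos.le]
    simp_rw [hsplit]
    rw [integral_const_mul, Measure.volume_eq_prod,
      integral_prod_mul (fun u : ℝ => (-2 * π * Complex.I * u) ^ k * φ x u)
        (fun v : ℝ => (-2 * π * Complex.I * v) ^ k * φ y v)]
    rw [Complex.ofReal_mul, Complex.ofReal_mul, iteratedDeriv_gaussian_eq_integral,
      iteratedDeriv_gaussian_eq_integral]
    generalize (∫ u : ℝ, (-2 * π * Complex.I * u) ^ k * φ x u) = A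
    generalize (∫ u : ℝ, (-2 * π * Complex.I * u) ^ k * φ y u) = B
    push_cast
    linear_combination ((r / 2 : ℂ) ^ k / k.factorial * (A * B)) * hpi
  have hlim : (π : ℂ) * ∫ p, f p = (((Real.sqrt (1 - r ^ 2))⁻¹ *
        Real.exp (-(x ^ 2 + y ^ 2 - 2 * r * x * y) / (1 - r ^ 2)) : ℝ) : ℂ) := by
    rw [Measure.volume_eq_prod, integral_prod _ hfint, integral_integral_cexp_mehler hr,
      ← Complex.ofReal_mul, mul_inv, mul_assoc, mul_inv_cancel_left₀ pi_ne_zero]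
  have := hsum.mul_left (π : ℂ)
  simp only [hF, hlim] at this
  exact Complex.hasSum_ofReal.1 this

lemma exp_mul_hermiteFun_mul_hermiteFun (t x y : ℝ) (k : ℕ) :
    Real.exp (-(2 * (k : ℝ) + 1) * t) * hermiteFun k x * hermiteFun k y =
      (Real.exp (-t) * (Real.sqrt π)⁻¹ * Real.exp ((x ^ 2 + y ^ 2) / 2)) *
      ((Real.exp (-(2 * t)) / 2) ^ k / k.factorial *
        (iteratedDeriv k (fun u => Real.exp (-u ^ 2)) x *
          iteratedDeriv k (fun u => Real.exp (-u ^ 2)) y)) := by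
  have hnormalization : ((2 : ℝ) ^ k * k.factorial * Real.sqrt π) ^ (-(1 : ℝ) / 2) *
      ((2 : ℝ) ^ k * k.factorial * Real.sqrt π) ^ (-(1 : ℝ) / 2) =
      ((2 : ℝ) ^ k * k.factorial * Real.sqrt π)⁻¹ := by
    rw [← Real.rpow_add (by positivity), ← Real.rpow_neg_one]
    norm_num
  have hexp : Real.exp (-(2 * (k : ℝ) + 1) * t) = Real.exp (-t) * Real.exp (-(2 * t)) ^ k := by
    rw [← Real.exp_nat_mul, ← Real.exp_add]
    congr 1
    ring
  have hgauss (z : ℝ) : Real.exp (z ^ 2) * Real.exp (-z ^ 2 / 2) = Real.exp (z ^ 2 / 2) := by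
    rw [← Real.exp_add]
    congr 1
    ring
  have hsign : ((-1 : ℝ) ^ k) * (-1) ^ k = 1 := by
    rw [← mul_pow]
    norm_num
  rw [hexp, add_div, Real.exp_add, ← hgauss x, ← hgauss y]
  simp only [hermiteFun, hermitePoly]
  generalize iteratedDeriv k (fun u => Real.exp (-u ^ 2)) x = A
  generalize iteratedDeriv k (fun u => Real.exp (-u ^ 2)) y = B
  generalize ((2 : ℝ) ^ k * k.factorial * Real.sqrt π) ^ (-(1 : ℝ) / 2) = N at hnormalization ⊢
  calc _ = (N * N) * ((-1) ^ k * (-1) ^ k) * (Real.exp (-t) * Real.exp (-(2 * t)) ^ k *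
        (Real.exp (x ^ 2) * Real.exp (-x ^ 2 / 2)) *
        (Real.exp (y ^ 2) * Real.exp (-y ^ 2 / 2)) * (A * B)) := by ring
    _ = _ := by
      rw [hnormalization, hsign, div_pow]
      field_simp

lemma mehler_kernel_eq {t : ℝ} (ht : 0 < t) (x y : ℝ) :
    (Real.exp (-t) * (Real.sqrt π)⁻¹ * Real.exp ((x ^ 2 + y ^ 2) / 2)) *
      ((Real.sqrt (1 - Real.exp (-(2 * t)) ^ 2))⁻¹ *
        Real.exp (-(x ^ 2 + y ^ 2 - 2 * Real.exp (-(2 * t)) * x * y) /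
          (1 - Real.exp (-(2 * t)) ^ 2))) =
      (2 * π * Real.sinh (2 * t)) ^ (-(1 : ℝ) / 2) *
        Real.exp (-(1 / 2) * (Real.cosh (2 * t) / Real.sinh (2 * t)) * (x ^ 2 + y ^ 2)
          + x * y / Real.sinh (2 * t)) := by
  set r := Real.exp (-(2 * t)) with hr
  have hr0 : 0 < r := Real.exp_pos _
  have hr1 : r < 1 := Real.exp_lt_one_iff.2 (by linarith)
  have hr2 : 0 < 1 - r ^ 2 := by nlinarith
  have hinv : Real.exp (2 * t) = r⁻¹ := by rw [hr, Real.exp_neg, inv_inv]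
  have hsinh : Real.sinh (2 * t) = (1 - r ^ 2) / (2 * r) := by
    rw [Real.sinh_eq, ← hr, hinv]
    field_simp
  have hcosh : Real.cosh (2 * t) = (1 + r ^ 2) / (2 * r) := by
    rw [Real.cosh_eq, ← hr, hinv]
    field_simp
  have hexp : Real.exp (-t) = Real.sqrt r := by
    rw [hr, Real.sqrt_eq_rpow, ← Real.exp_mul]
    congr 1
    ring
  have hconst : Real.exp (-t) * (Real.sqrt π)⁻¹ * (Real.sqrt (1 - r ^ 2))⁻¹ =
      (2 * π * Real.sinh (2 * t)) ^ (-(1 : ℝ) / 2) := by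
    rw [hsinh, show 2 * π * ((1 - r ^ 2) / (2 * r)) = (π * (1 - r ^ 2)) / r by field_simp,
      neg_div, Real.rpow_neg (by positivity), ← Real.sqrt_eq_rpow, Real.sqrt_div (by positivity),
      Real.sqrt_mul pi_pos.le, hexp]
    field_simp
  rw [← hconst, mul_mul_mul_comm, ← Real.exp_add]
  congr 2
  rw [hsinh, hcosh]
  field_simp
  ring

/-- Mehler's formula in dimension one: for every `t > 0` and `x, y ∈ ℝ`, the
series `Σ_k e^{−(2k+1)t} h_k(x) h_k(y)` converges absolutely and equals
`(2π sinh 2t)^{−1/2} exp(−(1/2) coth(2t)(x² + y²) + xy/sinh(2t))`. -/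
theorem mehler_formula_one_dim (t x y : ℝ) (ht : 0 < t) :
    Summable (fun k : ℕ => |Real.exp (-(2 * (k : ℝ) + 1) * t) * hermiteFun k x * hermiteFun k y|) ∧
    ∑' k : ℕ, Real.exp (-(2 * (k : ℝ) + 1) * t) * hermiteFun k x * hermiteFun k y
      = (2 * π * Real.sinh (2 * t)) ^ (-(1 : ℝ) / 2) *
        Real.exp (-(1 / 2) * (Real.cosh (2 * t) / Real.sinh (2 * t)) * (x ^ 2 + y ^ 2)
          + x * y / Real.sinh (2 * t)) := by
  have hr : |Real.exp (-(2 * t))| < 1 := by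
    rw [abs_of_pos (Real.exp_pos _)]
    exact Real.exp_lt_one_iff.2 (by linarith)
  have hsum := (hasSum_iteratedDeriv_gaussian_mul hr x y).mul_left
    (Real.exp (-t) * (Real.sqrt π)⁻¹ * Real.exp ((x ^ 2 + y ^ 2) / 2))
  simp only [← exp_mul_hermiteFun_mul_hermiteFun] at hsum
  rw [mehler_kernel_eq ht] at hsum
  exact ⟨hsum.summable.abs, hsum.tsum_eq⟩
end
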